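/- arXiv:2111.13541 — 6 statements merged into one kernel-verified Lean document; each statement's English description precedes it below -/
import Mathlib

section
/- Let e₁,…,e₅ be the standard basis of ℝ⁵ and let E ⊆ ⋀²(ℝ⁵) be the span of the three 2-forms e₂∧e₃ + e₄∧e₅, e₂∧e₄ − e₃∧e₅, e₂∧e₅ + e₃∧e₄ (the self-dual 2-forms of the subspace W spanned by e₂,…,e₅). Set E₁ = span{x ∧ v : x ∈ E, v ∈ ℝ⁵} ⊆ ⋀³(ℝ⁵). Then E is complete prime; explicitly, for every nonzero λ ∈ ℝ⁵: (a) every β ∈ ℝ⁵ with λ ∧ β ∈ E is a scalar multiple of λ; (b) every β ∈ ⋀²(ℝ⁵) with λ ∧ β ∈ E₁ lies in E + λ∧ℝ⁵; (c) ⋀³(ℝ⁵) = E₁ + λ∧⋀²(ℝ⁵). (These conditions say that for every nonzero λ the complex 0 → ⋀⁰ → ⋀¹ → ⋀²/E → ⋀³/E₁ → 0, with differentials induced by wedging with λ, is exact.) -/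
open ExteriorAlgebra

/-- the standard basis vectors of `ℝ⁵`, as elements of the exterior algebra
(`e 0, …, e 4` correspond to `e₁, …, e₅`). -/
noncomputable def e5 (i : Fin 5) : ExteriorAlgebra ℝ (Fin 5 → ℝ) :=
  ι ℝ (Pi.single i (1 : ℝ))

/-- `E = Λ⁺(W)`, the span of the three self-dual 2-forms of `W = span{e₂,…,e₅}`. -/
noncomputable def E5 : Submodule ℝ (ExteriorAlgebra ℝ (Fin 5 → ℝ)) :=
  Submodule.span ℝ
    {e5 1 * e5 2 + e5 3 * e5 4, e5 1 * e5 3 - e5 2 * e5 4, e5 1 * e5 4 + e5 2 * e5 3}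

/-- `E₁ = E·⋀¹ = span{x ∧ v : x ∈ E, v ∈ ℝ⁵} ⊆ ⋀³(ℝ⁵)`. -/
noncomputable def E5₁ : Submodule ℝ (ExteriorAlgebra ℝ (Fin 5 → ℝ)) :=
  Submodule.span ℝ {z | ∃ x ∈ E5, ∃ v : Fin 5 → ℝ, z = x * ι ℝ v}

noncomputable def c2 (s : Fin 2 → Fin 5) : ExteriorAlgebra ℝ (Fin 5 → ℝ) →ₗ[ℝ] ℝ :=
  liftAlternating (Pi.single 2
    ((Matrix.detRowAlternating (R := ℝ) (n := Fin 2)).compLinearMap (LinearMap.funLeft ℝ ℝ s)))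

noncomputable def c3 (s : Fin 3 → Fin 5) : ExteriorAlgebra ℝ (Fin 5 → ℝ) →ₗ[ℝ] ℝ :=
  liftAlternating (Pi.single 3
    ((Matrix.detRowAlternating (R := ℝ) (n := Fin 3)).compLinearMap (LinearMap.funLeft ℝ ℝ s)))

lemma c2_apply (i j : Fin 5) (a b : Fin 5 → ℝ) :
    c2 ![i, j] (ι ℝ a * ι ℝ b) = a i * b j - a j * b i := by
  have h : ι ℝ a * ι ℝ b = ιMulti ℝ 2 ![a, b] := by simp [ιMulti_apply]
  rw [h, c2, liftAlternating_apply_ιMulti, Pi.single_eq_same]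
  refine (Matrix.det_fin_two (Matrix.of fun r t => (![a, b] r) (![i, j] t))).trans ?_
  simp

lemma c3_apply (i j k : Fin 5) (a b c : Fin 5 → ℝ) :
    c3 ![i, j, k] (ι ℝ a * ι ℝ b * ι ℝ c) =
      a i * b j * c k - a i * b k * c j - a j * b i * c k + a j * b k * c i
        + a k * b i * c j - a k * b j * c i := by
  have h : ι ℝ a * ι ℝ b * ι ℝ c = ιMulti ℝ 3 ![a, b, c] := by simp [ιMulti_apply, mul_assoc]
  rw [h, c3, liftAlternating_apply_ιMulti, Pi.single_eq_same]
  refine (Matrix.det_fin_three (Matrix.of fun r t => (![a, b, c] r) (![i, j, k] t))).trans ?_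
  simp
  try ring

lemma c3_apply' (i j k : Fin 5) (a b c : Fin 5 → ℝ) :
    c3 ![i, j, k] (ι ℝ a * (ι ℝ b * ι ℝ c)) =
      a i * b j * c k - a i * b k * c j - a j * b i * c k + a j * b k * c i
        + a k * b i * c j - a k * b j * c i := by
  rw [← mul_assoc, c3_apply]

lemma ι_eq (u : Fin 5 → ℝ) :
    ι ℝ u = u 0 • e5 0 + u 1 • e5 1 + u 2 • e5 2 + u 3 • e5 3 + u 4 • e5 4 := by
  have : u = ∑ i, u i • (Pi.single i (1:ℝ) : Fin 5 → ℝ) := by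
    ext j; simp [Finset.sum_apply, Pi.single_apply]
  conv_lhs => rw [this]
  simp [Fin.sum_univ_five, e5]

lemma e5_sq (i : Fin 5) : e5 i * e5 i = 0 := by simp [e5]

lemma e5_anti (i j : Fin 5) : e5 j * e5 i = - (e5 i * e5 j) :=
  eq_neg_of_add_eq_zero_left (ι_add_mul_swap _ _)

lemma e5_sq' (i : Fin 5) (x) : e5 i * (e5 i * x) = 0 := by rw [← mul_assoc, e5_sq, zero_mul]

lemma e5_anti' (i j : Fin 5) (x) : e5 j * (e5 i * x) = - (e5 i * (e5 j * x)) := by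
  rw [← mul_assoc, e5_anti i j, neg_mul, mul_assoc]

/-- 2-forms in coordinates. -/
noncomputable def T2 (b01 b02 b03 b04 b12 b13 b14 b23 b24 b34 : ℝ) :
    ExteriorAlgebra ℝ (Fin 5 → ℝ) :=
  b01 • (e5 0 * e5 1) + b02 • (e5 0 * e5 2) + b03 • (e5 0 * e5 3) + b04 • (e5 0 * e5 4)
  + b12 • (e5 1 * e5 2) + b13 • (e5 1 * e5 3) + b14 • (e5 1 * e5 4)
  + b23 • (e5 2 * e5 3) + b24 • (e5 2 * e5 4) + b34 • (e5 3 * e5 4)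

/-- 3-forms in coordinates. -/
noncomputable def T3 (g012 g013 g014 g023 g024 g034 g123 g124 g134 g234 : ℝ) :
    ExteriorAlgebra ℝ (Fin 5 → ℝ) :=
  g012 • (e5 0 * (e5 1 * e5 2)) + g013 • (e5 0 * (e5 1 * e5 3)) + g014 • (e5 0 * (e5 1 * e5 4))
  + g023 • (e5 0 * (e5 2 * e5 3)) + g024 • (e5 0 * (e5 2 * e5 4)) + g034 • (e5 0 * (e5 3 * e5 4))
  + g123 • (e5 1 * (e5 2 * e5 3)) + g124 • (e5 1 * (e5 2 * e5 4)) + g134 • (e5 1 * (e5 3 * e5 4))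
  + g234 • (e5 2 * (e5 3 * e5 4))

lemma mul_T2 (u v : Fin 5 → ℝ) : ι ℝ u * ι ℝ v =
    T2 (u 0 * v 1 - u 1 * v 0) (u 0 * v 2 - u 2 * v 0) (u 0 * v 3 - u 3 * v 0)
      (u 0 * v 4 - u 4 * v 0) (u 1 * v 2 - u 2 * v 1) (u 1 * v 3 - u 3 * v 1)
      (u 1 * v 4 - u 4 * v 1) (u 2 * v 3 - u 3 * v 2) (u 2 * v 4 - u 4 * v 2)
      (u 3 * v 4 - u 4 * v 3) := by
  rw [ι_eq u, ι_eq v, T2]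
  simp only [mul_add, add_mul, smul_mul_assoc, mul_smul_comm, e5_sq,
    e5_anti 0 1, e5_anti 0 2, e5_anti 0 3, e5_anti 0 4, e5_anti 1 2, e5_anti 1 3, e5_anti 1 4,
    e5_anti 2 3, e5_anti 2 4, e5_anti 3 4]
  module

lemma mul_T3 (u : Fin 5 → ℝ) (b01 b02 b03 b04 b12 b13 b14 b23 b24 b34 : ℝ) :
    ι ℝ u * T2 b01 b02 b03 b04 b12 b13 b14 b23 b24 b34 =
    T3 (u 0 * b12 - u 1 * b02 + u 2 * b01) (u 0 * b13 - u 1 * b03 + u 3 * b01)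
      (u 0 * b14 - u 1 * b04 + u 4 * b01) (u 0 * b23 - u 2 * b03 + u 3 * b02)
      (u 0 * b24 - u 2 * b04 + u 4 * b02) (u 0 * b34 - u 3 * b04 + u 4 * b03)
      (u 1 * b23 - u 2 * b13 + u 3 * b12) (u 1 * b24 - u 2 * b14 + u 4 * b12)
      (u 1 * b34 - u 3 * b14 + u 4 * b13) (u 2 * b34 - u 3 * b24 + u 4 * b23) := by
  rw [ι_eq u, T2, T3]
  simp only [mul_add, add_mul, smul_mul_assoc, mul_smul_comm, e5_sq, e5_sq',
    e5_anti 0 1, e5_anti 0 2, e5_anti 0 3, e5_anti 0 4, e5_anti 1 2, e5_anti 1 3, e5_anti 1 4,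
    e5_anti 2 3, e5_anti 2 4, e5_anti 3 4,
    e5_anti' 0 1, e5_anti' 0 2, e5_anti' 0 3, e5_anti' 0 4, e5_anti' 1 2, e5_anti' 1 3,
    e5_anti' 1 4, e5_anti' 2 3, e5_anti' 2 4, e5_anti' 3 4, mul_neg, mul_zero]
  module

lemma exists_T2 (β) (h : β ∈ ⋀[ℝ]^2 (Fin 5 → ℝ)) :
    ∃ b01 b02 b03 b04 b12 b13 b14 b23 b24 b34 : ℝ,
      β = T2 b01 b02 b03 b04 b12 b13 b14 b23 b24 b34 := by
  rw [exteriorPower, pow_two] at h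
  induction h using Submodule.mul_induction_on' with
  | mem_mul_mem m hm n hn =>
    obtain ⟨u, rfl⟩ := hm
    obtain ⟨v, rfl⟩ := hn
    exact ⟨_, _, _, _, _, _, _, _, _, _, mul_T2 u v⟩
  | add x _ y _ hx hy =>
    obtain ⟨a1, a2, a3, a4, a5, a6, a7, a8, a9, a10, rfl⟩ := hx
    obtain ⟨b1, b2, b3, b4, b5, b6, b7, b8, b9, b10, rfl⟩ := hy
    refine ⟨a1 + b1, a2 + b2, a3 + b3, a4 + b4, a5 + b5, a6 + b6, a7 + b7, a8 + b8, a9 + b9,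
      a10 + b10, ?_⟩
    simp only [T2]; module

lemma exists_T3 (β) (h : β ∈ ⋀[ℝ]^3 (Fin 5 → ℝ)) :
    ∃ b01 b02 b03 b04 b12 b13 b14 b23 b24 b34 : ℝ,
      β = T3 b01 b02 b03 b04 b12 b13 b14 b23 b24 b34 := by
  rw [exteriorPower, pow_succ'] at h
  induction h using Submodule.mul_induction_on' with
  | mem_mul_mem m hm n hn =>
    obtain ⟨u, rfl⟩ := hm
    obtain ⟨a1, a2, a3, a4, a5, a6, a7, a8, a9, a10, rfl⟩ := exists_T2 n hn
    exact ⟨_, _, _, _, _, _, _, _, _, _, mul_T3 u ..⟩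
  | add x _ y _ hx hy =>
    obtain ⟨a1, a2, a3, a4, a5, a6, a7, a8, a9, a10, rfl⟩ := hx
    obtain ⟨b1, b2, b3, b4, b5, b6, b7, b8, b9, b10, rfl⟩ := hy
    refine ⟨a1 + b1, a2 + b2, a3 + b3, a4 + b4, a5 + b5, a6 + b6, a7 + b7, a8 + b8, a9 + b9,
      a10 + b10, ?_⟩
    simp only [T3]; module

lemma e5_mul_mem (i j : Fin 5) : e5 i * e5 j ∈ ⋀[ℝ]^2 (Fin 5 → ℝ) := by
  rw [exteriorPower, pow_two]
  exact Submodule.mul_mem_mul ⟨_, rfl⟩ ⟨_, rfl⟩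

lemma T2_mem (b01 b02 b03 b04 b12 b13 b14 b23 b24 b34 : ℝ) :
    T2 b01 b02 b03 b04 b12 b13 b14 b23 b24 b34 ∈ ⋀[ℝ]^2 (Fin 5 → ℝ) := by
  unfold T2
  repeat' apply Submodule.add_mem
  all_goals exact Submodule.smul_mem _ _ (e5_mul_mem _ _)

lemma E5_form (x) (hx : x ∈ E5) : ∃ a b c : ℝ, x = T2 0 0 0 0 a b c c (-b) a := by
  unfold E5 at hx
  simp only [Submodule.mem_span_insert, Submodule.mem_span_singleton] at hx
  obtain ⟨a, _, ⟨b, _, ⟨c, rfl⟩, rfl⟩, rfl⟩ := hx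
  refine ⟨a, b, c, ?_⟩
  simp only [T2]; module

lemma form_E5 (a b c : ℝ) : T2 0 0 0 0 a b c c (-b) a ∈ E5 := by
  unfold E5
  simp only [Submodule.mem_span_insert, Submodule.mem_span_singleton]
  refine ⟨a, _, ⟨b, _, ⟨c, rfl⟩, rfl⟩, ?_⟩
  simp only [T2]; module

lemma E5₁_form (x) (hx : x ∈ E5₁) : ∃ a b c p q r s : ℝ,
    x = T3 a b c c (-b) a p q r s := by
  unfold E5₁ at hx
  induction hx using Submodule.span_induction with
  | mem x h =>
    obtain ⟨y, hy, v, rfl⟩ := h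
    obtain ⟨a, b, c, rfl⟩ := E5_form y hy
    have : T2 0 0 0 0 a b c c (-b) a * ι ℝ v = ι ℝ v * T2 0 0 0 0 a b c c (-b) a := by
      have hh : ∀ i j, e5 i * e5 j * ι ℝ v = ι ℝ v * (e5 i * e5 j) := by
        intro i j
        have h1 : ∀ k, e5 k * ι ℝ v = - (ι ℝ v * e5 k) := fun k =>
          eq_neg_of_add_eq_zero_left (ι_add_mul_swap _ _)
        rw [mul_assoc, h1, mul_neg, ← mul_assoc, h1, neg_mul, neg_neg, mul_assoc]
      simp only [T2, add_mul, mul_add, smul_mul_assoc, mul_smul_comm, hh]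
    refine ⟨v 0 * a, v 0 * b, v 0 * c, v 1 * c - v 2 * b + v 3 * a, v 1 * (-b) - v 2 * c + v 4 * a,
      v 1 * a - v 3 * c + v 4 * b, v 2 * a - v 3 * (-b) + v 4 * c, ?_⟩
    rw [this, mul_T3]
    congr 1 <;> ring
  | zero => exact ⟨0, 0, 0, 0, 0, 0, 0, by simp [T3]⟩
  | add x y _ _ hx hy =>
    obtain ⟨a1, a2, a3, a4, a5, a6, a7, rfl⟩ := hx
    obtain ⟨b1, b2, b3, b4, b5, b6, b7, rfl⟩ := hy
    refine ⟨a1 + b1, a2 + b2, a3 + b3, a4 + b4, a5 + b5, a6 + b6, a7 + b7, ?_⟩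
    simp only [T3]; module
  | smul t x _ hx =>
    obtain ⟨a1, a2, a3, a4, a5, a6, a7, rfl⟩ := hx
    refine ⟨t * a1, t * a2, t * a3, t * a4, t * a5, t * a6, t * a7, ?_⟩
    simp only [T3]; module

lemma form_E5₁ (a b c p q r s : ℝ) : T3 a b c c (-b) a p q r s ∈ E5₁ := by
  have key : ∀ (a b c : ℝ) (v : Fin 5 → ℝ), ι ℝ v * T2 0 0 0 0 a b c c (-b) a ∈ E5₁ := by
    intro a b c v
    refine Submodule.subset_span ⟨_, form_E5 a b c, v, ?_⟩
    have hh : ∀ i j, e5 i * e5 j * ι ℝ v = ι ℝ v * (e5 i * e5 j) := by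
      intro i j
      have h1 : ∀ k, e5 k * ι ℝ v = - (ι ℝ v * e5 k) := fun k =>
        eq_neg_of_add_eq_zero_left (ι_add_mul_swap _ _)
      rw [mul_assoc, h1, mul_neg, ← mul_assoc, h1, neg_mul, neg_neg, mul_assoc]
    simp only [T2, add_mul, mul_add, smul_mul_assoc, mul_smul_comm, hh]
  have : T3 a b c c (-b) a p q r s =
      ι ℝ ![1, 0, 0, 0, 0] * T2 0 0 0 0 a b c c (-b) a
      + ι ℝ ![0, r, s, p, q] * T2 0 0 0 0 1 0 0 0 (-0) 1 := by
    rw [mul_T3, mul_T3]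
    simp [T3]
    module
  rw [this]
  exact add_mem (key _ _ _ _) (key _ _ _ _)

lemma c2_inj {b01 b02 b03 b04 b12 b13 b14 b23 b24 b34 : ℝ}
    {a01 a02 a03 a04 a12 a13 a14 a23 a24 a34 : ℝ}
    (h : T2 b01 b02 b03 b04 b12 b13 b14 b23 b24 b34 = T2 a01 a02 a03 a04 a12 a13 a14 a23 a24 a34) :
    b01 = a01 ∧ b02 = a02 ∧ b03 = a03 ∧ b04 = a04 ∧ b12 = a12 ∧ b13 = a13 ∧ b14 = a14 ∧ b23 = a23
      ∧ b24 = a24 ∧ b34 = a34 := by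
  have H := fun i j => congrArg (c2 ![i, j]) h
  simp only [T2, e5, map_add, map_smul, c2_apply, smul_eq_mul] at H
  have h1 := H 0 1
  have h2 := H 0 2
  have h3 := H 0 3
  have h4 := H 0 4
  have h5 := H 1 2
  have h6 := H 1 3
  have h7 := H 1 4
  have h8 := H 2 3
  have h9 := H 2 4
  have h10 := H 3 4
  clear H h
  simp [Pi.single_apply] at h1 h2 h3 h4 h5 h6 h7 h8 h9 h10
  exact ⟨h1, h2, h3, h4, h5, h6, h7, h8, h9, h10⟩

lemma c3_inj {b01 b02 b03 b04 b12 b13 b14 b23 b24 b34 : ℝ}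
    {a01 a02 a03 a04 a12 a13 a14 a23 a24 a34 : ℝ}
    (h : T3 b01 b02 b03 b04 b12 b13 b14 b23 b24 b34 = T3 a01 a02 a03 a04 a12 a13 a14 a23 a24 a34) :
    b01 = a01 ∧ b02 = a02 ∧ b03 = a03 ∧ b04 = a04 ∧ b12 = a12 ∧ b13 = a13 := by
  have H := fun i j k => congrArg (c3 ![i, j, k]) h
  simp only [T3, e5, map_add, map_smul, c3_apply', smul_eq_mul] at H
  have h1 := H 0 1 2
  have h2 := H 0 1 3
  have h3 := H 0 1 4
  have h4 := H 0 2 3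
  have h5 := H 0 2 4
  have h6 := H 0 3 4
  clear H h
  simp [Pi.single_apply] at h1 h2 h3 h4 h5 h6
  exact ⟨h1, h2, h3, h4, h5, h6⟩

lemma T2_add (a1 a2 a3 a4 a5 a6 a7 a8 a9 a10 b1 b2 b3 b4 b5 b6 b7 b8 b9 b10 : ℝ) :
    T2 a1 a2 a3 a4 a5 a6 a7 a8 a9 a10 + T2 b1 b2 b3 b4 b5 b6 b7 b8 b9 b10 =
    T2 (a1 + b1) (a2 + b2) (a3 + b3) (a4 + b4) (a5 + b5) (a6 + b6) (a7 + b7) (a8 + b8) (a9 + b9)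
      (a10 + b10) := by
  simp only [T2]; module

lemma T3_add (a1 a2 a3 a4 a5 a6 a7 a8 a9 a10 b1 b2 b3 b4 b5 b6 b7 b8 b9 b10 : ℝ) :
    T3 a1 a2 a3 a4 a5 a6 a7 a8 a9 a10 + T3 b1 b2 b3 b4 b5 b6 b7 b8 b9 b10 =
    T3 (a1 + b1) (a2 + b2) (a3 + b3) (a4 + b4) (a5 + b5) (a6 + b6) (a7 + b7) (a8 + b8) (a9 + b9)
      (a10 + b10) := by
  simp only [T3]; module

lemma part_a (u : Fin 5 → ℝ) (hu : u ≠ 0) (v : Fin 5 → ℝ) (h : ι ℝ u * ι ℝ v ∈ E5) :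
    ∃ c : ℝ, v = c • u := by
  obtain ⟨a, b, c, h⟩ := E5_form _ h
  rw [mul_T2] at h
  obtain ⟨h1, h2, h3, h4, h5, h6, h7, h8, h9, h10⟩ := c2_inj h
  have hs : a ^ 2 + b ^ 2 + c ^ 2 = 0 := by
    have : a * a - b * (-b) + c * c = 0 := by
      rw [← h9]; nth_rewrite 2 [← h10]; nth_rewrite 2 [← h8]
      rw [← h5, ← h6, ← h7]; ring
    linarith
  have ha : a = 0 := by nlinarith [sq_nonneg a, sq_nonneg b, sq_nonneg c]
  have hb : b = 0 := by nlinarith [sq_nonneg a, sq_nonneg b, sq_nonneg c]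
  have hc : c = 0 := by nlinarith [sq_nonneg a, sq_nonneg b, sq_nonneg c]
  subst ha hb hc
  obtain ⟨k, hk⟩ := Function.ne_iff.mp hu
  have hk' : u k ≠ 0 := hk
  refine ⟨v k / u k, ?_⟩
  have key : ∀ i j, u i * v j = u j * v i := by
    intro i j
    fin_cases i <;> fin_cases j <;> simp <;> linarith
  ext j
  simp only [Pi.smul_apply, smul_eq_mul]
  rw [div_mul_eq_mul_div, eq_div_iff hk']
  linarith [key j k]

lemma norm_ne (u : Fin 5 → ℝ) (hu : u ≠ 0) (h0 : u 0 = 0) :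
    u 1 ^ 2 + u 2 ^ 2 + u 3 ^ 2 + u 4 ^ 2 ≠ 0 := by
  intro h
  apply hu
  have h1 : u 1 = 0 := by nlinarith [sq_nonneg (u 1), sq_nonneg (u 2), sq_nonneg (u 3), sq_nonneg (u 4)]
  have h2 : u 2 = 0 := by nlinarith [sq_nonneg (u 1), sq_nonneg (u 2), sq_nonneg (u 3), sq_nonneg (u 4)]
  have h3 : u 3 = 0 := by nlinarith [sq_nonneg (u 1), sq_nonneg (u 2), sq_nonneg (u 3), sq_nonneg (u 4)]
  have h4 : u 4 = 0 := by nlinarith [sq_nonneg (u 1), sq_nonneg (u 2), sq_nonneg (u 3), sq_nonneg (u 4)]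
  ext i
  fin_cases i <;> simp [*]

/-- solving `(w ∧ v)⁻ = d` for `v`, when `w ≠ 0`. -/
lemma solve (w1 w2 w3 w4 d1 d2 d3 : ℝ) (h : w1 ^ 2 + w2 ^ 2 + w3 ^ 2 + w4 ^ 2 ≠ 0) :
    ∃ v1 v2 v3 v4 : ℝ, w1 * v2 - w2 * v1 - w3 * v4 + w4 * v3 = d1 ∧
      w1 * v3 - w3 * v1 + w2 * v4 - w4 * v2 = d2 ∧
      w1 * v4 - w4 * v1 - w2 * v3 + w3 * v2 = d3 := by
  refine ⟨(-d1 * w2 - d2 * w3 - d3 * w4) / (w1 ^ 2 + w2 ^ 2 + w3 ^ 2 + w4 ^ 2),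
    (d1 * w1 - d2 * w4 + d3 * w3) / (w1 ^ 2 + w2 ^ 2 + w3 ^ 2 + w4 ^ 2),
    (d1 * w4 + d2 * w1 - d3 * w2) / (w1 ^ 2 + w2 ^ 2 + w3 ^ 2 + w4 ^ 2),
    (-d1 * w3 + d2 * w2 + d3 * w1) / (w1 ^ 2 + w2 ^ 2 + w3 ^ 2 + w4 ^ 2), ?_, ?_, ?_⟩ <;>
  · field_simp
    ring

lemma part_b (u : Fin 5 → ℝ) (hu : u ≠ 0) (β) (hβ : β ∈ ⋀[ℝ]^2 (Fin 5 → ℝ))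
    (h : ι ℝ u * β ∈ E5₁) : ∃ x ∈ E5, ∃ v : Fin 5 → ℝ, β = x + ι ℝ u * ι ℝ v := by
  obtain ⟨b01, b02, b03, b04, b12, b13, b14, b23, b24, b34, rfl⟩ := exists_T2 β hβ
  obtain ⟨a, b, c, p, q, r, s, h⟩ := E5₁_form _ h
  rw [mul_T3] at h
  obtain ⟨h1, h2, h3, h4, h5, h6⟩ := c3_inj h
  suffices hv : ∃ v0 v1 v2 v3 v4 : ℝ, b01 = u 0 * v1 - u 1 * v0 ∧ b02 = u 0 * v2 - u 2 * v0 ∧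
      b03 = u 0 * v3 - u 3 * v0 ∧ b04 = u 0 * v4 - u 4 * v0 ∧
      u 1 * v2 - u 2 * v1 - u 3 * v4 + u 4 * v3 = b12 - b34 ∧
      u 1 * v3 - u 3 * v1 + u 2 * v4 - u 4 * v2 = b13 + b24 ∧
      u 1 * v4 - u 4 * v1 - u 2 * v3 + u 3 * v2 = b14 - b23 by
    obtain ⟨v0, v1, v2, v3, v4, e1, e2, e3, e4, e5', e6, e7⟩ := hv
    refine ⟨_, form_E5 (b12 - (u 1 * v2 - u 2 * v1)) (b13 - (u 1 * v3 - u 3 * v1))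
      (b14 - (u 1 * v4 - u 4 * v1)), ![v0, v1, v2, v3, v4], ?_⟩
    rw [mul_T2, T2_add]
    congr 1 <;> simp <;> linarith
  by_cases h0 : u 0 = 0
  · have hN := norm_ne u hu h0
    obtain ⟨v1, v2, v3, v4, hv⟩ := solve (u 1) (u 2) (u 3) (u 4) (b12 - b34) (b13 + b24)
      (b14 - b23) hN
    have f1 : u 1 * b02 - u 2 * b01 - u 3 * b04 + u 4 * b03 = 0 := by
      rw [h0] at h1 h6; linarith
    have f2 : u 1 * b03 - u 3 * b01 + u 2 * b04 - u 4 * b02 = 0 := by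
      rw [h0] at h2 h5; linarith
    have f3 : u 1 * b04 - u 4 * b01 - u 2 * b03 + u 3 * b02 = 0 := by
      rw [h0] at h3 h4; linarith
    refine ⟨-(b01 * u 1 + b02 * u 2 + b03 * u 3 + b04 * u 4) /
      (u 1 ^ 2 + u 2 ^ 2 + u 3 ^ 2 + u 4 ^ 2), v1, v2, v3, v4, ?_, ?_, ?_, ?_, hv⟩ <;>
    rw [h0] <;> field_simp
    · linear_combination -u 2 * f1 - u 3 * f2 - u 4 * f3
    · linear_combination u 1 * f1 - u 4 * f2 + u 3 * f3
    · linear_combination u 4 * f1 + u 1 * f2 - u 2 * f3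
    · linear_combination -u 3 * f1 + u 2 * f2 + u 1 * f3
  · refine ⟨0, b01 / u 0, b02 / u 0, b03 / u 0, b04 / u 0, ?_, ?_, ?_, ?_, ?_, ?_, ?_⟩ <;>
      field_simp
    · ring
    · ring
    · ring
    · ring
    · linear_combination h6 - h1
    · linear_combination -h2 - h5
    · linear_combination h4 - h3

lemma part_c (u : Fin 5 → ℝ) (hu : u ≠ 0) (γ) (hγ : γ ∈ ⋀[ℝ]^3 (Fin 5 → ℝ)) :
    ∃ x ∈ E5₁, ∃ β ∈ ⋀[ℝ]^2 (Fin 5 → ℝ), γ = x + ι ℝ u * β := by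
  obtain ⟨g012, g013, g014, g023, g024, g034, g123, g124, g134, g234, rfl⟩ := exists_T3 γ hγ
  suffices hv : ∃ b01 b02 b03 b04 b12 b13 b14 : ℝ,
      (u 0 * b12 - u 1 * b02 + u 2 * b01) - (- u 3 * b04 + u 4 * b03) = g012 - g034 ∧
      (u 0 * b13 - u 1 * b03 + u 3 * b01) + (- u 2 * b04 + u 4 * b02) = g013 + g024 ∧
      (u 0 * b14 - u 1 * b04 + u 4 * b01) - (- u 2 * b03 + u 3 * b02) = g014 - g023 by
    obtain ⟨b01, b02, b03, b04, b12, b13, b14, k1, k2, k3⟩ := hv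
    refine ⟨_, form_E5₁ (g012 - (u 0 * b12 - u 1 * b02 + u 2 * b01))
      (g013 - (u 0 * b13 - u 1 * b03 + u 3 * b01)) (g014 - (u 0 * b14 - u 1 * b04 + u 4 * b01))
      (g123 - (u 1 * 0 - u 2 * b13 + u 3 * b12)) (g124 - (u 1 * 0 - u 2 * b14 + u 4 * b12))
      (g134 - (u 1 * 0 - u 3 * b14 + u 4 * b13)) (g234 - (u 2 * 0 - u 3 * 0 + u 4 * 0)),
      _, T2_mem b01 b02 b03 b04 b12 b13 b14 0 0 0, ?_⟩
    rw [mul_T3, T3_add]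
    congr 1 <;> linarith
  by_cases h0 : u 0 = 0
  · obtain ⟨v1, v2, v3, v4, k1, k2, k3⟩ := solve (u 1) (u 2) (u 3) (u 4) (g034 - g012)
      (-(g013 + g024)) (g023 - g014) (norm_ne u hu h0)
    refine ⟨v1, v2, v3, v4, 0, 0, 0, ?_, ?_, ?_⟩ <;> linarith
  · refine ⟨0, 0, 0, 0, (g012 - g034) / u 0, (g013 + g024) / u 0, (g014 - g023) / u 0,
      ?_, ?_, ?_⟩ <;> field_simp <;> ring

/-- the self-dual 2-forms of `W = ⟨e₂,…,e₅⟩ ⊆ ℝ⁵` form a complete prime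
subspace of `⋀²(ℝ⁵)`: for every nonzero `λ ∈ ℝ⁵` the complex
`0 → ⋀⁰ → ⋀¹ → ⋀²/E → ⋀³/E₁ → 0` (wedging with `λ`) is exact. -/
theorem stmt_2 :
    ∀ lam : Fin 5 → ℝ, lam ≠ 0 →
      (∀ β : Fin 5 → ℝ, ι ℝ lam * ι ℝ β ∈ E5 → ∃ c : ℝ, β = c • lam) ∧
      (∀ β ∈ ⋀[ℝ]^2 (Fin 5 → ℝ), ι ℝ lam * β ∈ E5₁ →
        ∃ x ∈ E5, ∃ v : Fin 5 → ℝ, β = x + ι ℝ lam * ι ℝ v) ∧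
      (∀ γ ∈ ⋀[ℝ]^3 (Fin 5 → ℝ), ∃ x ∈ E5₁, ∃ β ∈ ⋀[ℝ]^2 (Fin 5 → ℝ),
        γ = x + ι ℝ lam * β) := by
  intro lam hlam
  exact ⟨part_a lam hlam, part_b lam hlam, part_c lam hlam⟩
end

section
/- Let n ≥ 4 and let MP(n) denote the maximal dimension of a prime subspace of ⋀²(ℝⁿ). If MP(n) = (n−1)(n−2)/2, then MP(n+1) = MP(n); that is, if every prime subspace of ⋀²(ℝⁿ) has dimension at most (n−1)(n−2)/2 and some prime subspace attains this dimension, then the maximal dimension of a prime subspace of ⋀²(ℝ^{n+1}) is also (n−1)(n−2)/2. -/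
set_option synthInstance.maxHeartbeats 1000000
set_option maxHeartbeats 1000000

open ExteriorAlgebra

/-- A subspace of the exterior algebra is prime if each of its nonzero elements has
injective wedge multiplication by vectors. -/
def IsPrimeSub {V : Type*} [AddCommGroup V] [Module ℝ V]
    (E : Submodule ℝ (ExteriorAlgebra ℝ V)) : Prop :=
  ∀ x ∈ E, x ≠ 0 → ∀ μ : V, μ ≠ 0 → x * ι ℝ μ ≠ 0



theorem prime_extend (n : ℕ) (hn : 1 ≤ n) (E : Submodule ℝ (ExteriorAlgebra ℝ (Fin n → ℝ)))
    (hE : E ≤ ⋀[ℝ]^2 (Fin n → ℝ)) (hp : IsPrimeSub E) :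
    ∃ E' : Submodule ℝ (ExteriorAlgebra ℝ (Fin (n + 1) → ℝ)),
      E' ≤ ⋀[ℝ]^2 (Fin (n + 1) → ℝ) ∧ IsPrimeSub E' ∧
        Module.finrank ℝ E' = Module.finrank ℝ E := by
  classical
  let j : (Fin n → ℝ) →ₗ[ℝ] (Fin (n+1) → ℝ) :=
    LinearMap.pi (Fin.snoc (α := fun _ => (Fin n → ℝ) →ₗ[ℝ] ℝ) (fun i => LinearMap.proj i) 0)
  let q : (Fin n → ℝ) → (Fin (n+1) → ℝ) →ₗ[ℝ] (Fin n → ℝ) := fun w =>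
    LinearMap.pi (fun i => LinearMap.proj i.castSucc + (w i) • LinearMap.proj (Fin.last n))
  have hqj : ∀ w, q w ∘ₗ j = LinearMap.id := by
    intro w; ext x i; simp [q, j]
  have hinj : Function.Injective (ExteriorAlgebra.map j) := by
    have : (ExteriorAlgebra.map (q 0)).comp (ExteriorAlgebra.map j) = AlgHom.id _ _ := by
      rw [map_comp_map, hqj, map_id]
    exact Function.LeftInverse.injective (g := ExteriorAlgebra.map (q 0)) fun x => by
      exact DFunLike.congr_fun this x
  have hqj' : ∀ w x, ExteriorAlgebra.map (q w) (ExteriorAlgebra.map j x) = x := by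
    intro w x
    have : (ExteriorAlgebra.map (q w)).comp (ExteriorAlgebra.map j) = AlgHom.id _ _ := by
      rw [map_comp_map, hqj, map_id]
    exact DFunLike.congr_fun this x
  refine ⟨E.map (ExteriorAlgebra.map j).toLinearMap, ?_, ?_, ?_⟩
  · rw [Submodule.map_le_iff_le_comap]
    refine hE.trans ?_
    rw [← Submodule.map_le_iff_le_comap, exteriorPower, exteriorPower, Submodule.map_pow]
    apply pow_le_pow_left'
    rintro _ ⟨_, ⟨v, rfl⟩, rfl⟩
    exact ⟨j v, by simp⟩
  · rintro _ ⟨x, hx, rfl⟩ hx0 μ hμ h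
    have hx0' : x ≠ 0 := by rintro rfl; simp at hx0
    have h2 : ∀ w, x * ι ℝ (q w μ) = 0 := by
      intro w
      have := congrArg (ExteriorAlgebra.map (q w)) h
      simpa [hqj'] using this
    have h3 : ∀ w, q w μ = 0 := by
      intro w; by_contra hne
      exact hp x hx hx0' _ hne (h2 w)
    apply hμ
    have h0 := h3 0
    have h1 := h3 1
    ext i
    refine Fin.lastCases ?_ (fun i => ?_) i
    · have a := congrFun h0 ⟨0, hn⟩
      have b := congrFun h1 ⟨0, hn⟩
      simp [q] at a b
      simpa [a] using b
    · have a := congrFun h0 i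
      simpa [q] using a
  · exact ((Submodule.equivMapOfInjective (ExteriorAlgebra.map j).toLinearMap hinj E).finrank_eq).symm

theorem wedge_zero {p : ℕ} (u v : Fin p → ℝ) (h : ι ℝ u * ι ℝ v = 0) (hv : v ≠ 0) :
    ∃ c : ℝ, u = c • v := by
  by_contra hne
  push Not at hne
  have hli : LinearIndependent ℝ ![v, u] := by
    rw [LinearIndependent.pair_iff' hv]
    exact fun a h => hne a h.symm
  have := exteriorPower.ιMulti_family_linearIndependent_field (n := 2) hli
  have h0 := this.ne_zero ⟨Finset.univ, by simp⟩
  apply h0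
  have h1 : ι ℝ v * ι ℝ u = 0 := by
    have := ι_add_mul_swap (R := ℝ) v u
    rw [h, add_zero] at this
    exact this
  ext
  simp only [exteriorPower.ιMulti_family_apply_coe, ZeroMemClass.coe_zero]
  rw [ExteriorAlgebra.ιMulti_family, ιMulti_apply]
  have e : ∀ i : Fin 2, (Set.powersetCard.ofFinEmbEquiv.symm (⟨Finset.univ, by simp⟩ : Set.powersetCard (Fin 2) 2)) i = i := by
    generalize Set.powersetCard.ofFinEmbEquiv.symm
      (⟨Finset.univ, by simp⟩ : Set.powersetCard (Fin 2) 2) = φ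
    have hlt : φ 0 < φ 1 := φ.strictMono (by decide)
    have a0 := (φ 0).2
    have a1 := (φ 1).2
    intro i
    fin_cases i
    · ext; simp; omega
    · ext; simp; omega
  simp [e, h1]

theorem bilin_of_prime (p d : ℕ) (E : Submodule ℝ (ExteriorAlgebra ℝ (Fin p → ℝ)))
    (hE : E ≤ ⋀[ℝ]^2 (Fin p → ℝ)) (hp : IsPrimeSub E)
    (hd : p.choose 2 ≤ Module.finrank ℝ E + d) :
    ∃ Q : (Fin p → ℝ) →ₗ[ℝ] (Fin p → ℝ) →ₗ[ℝ] (Fin (d + 1) → ℝ),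
      ∀ u v, Q u v = 0 → u = 0 ∨ v = 0 := by
  let P := ⋀[ℝ]^2 (Fin p → ℝ)
  let E2 : Submodule ℝ P := E.comap P.subtype
  have hE2 : Module.finrank ℝ E2 = Module.finrank ℝ E :=
    (Submodule.comapSubtypeEquivOfLe hE).finrank_eq
  have hq : Module.finrank ℝ (P ⧸ E2) ≤ Module.finrank ℝ (Fin d → ℝ) := by
    have h1 := Submodule.finrank_quotient_add_finrank E2
    have h2 : Module.finrank ℝ P = p.choose 2 := by
      rw [exteriorPower.finrank_eq]; simp
    simp; omega
  obtain ⟨f, hf⟩ : ∃ f : (P ⧸ E2) →ₗ[ℝ] (Fin d → ℝ), ∀ x, f x = 0 → x = 0 := by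
    let b := Module.finBasis ℝ (P ⧸ E2)
    refine ⟨LinearMap.pi fun i => if h : i.1 < Module.finrank ℝ (P ⧸ E2) then b.coord ⟨i, h⟩ else 0,
      fun x hx => ?_⟩
    rw [← b.forall_coord_eq_zero_iff]
    intro i
    have hi : i.1 < d := by have := i.2; simp at hq; omega
    have := congrFun hx ⟨i.1, hi⟩
    simpa using this
  have hmem : ∀ u v : Fin p → ℝ, ι ℝ u * ι ℝ v ∈ P := by
    intro u v
    show _ ∈ (LinearMap.range (ι ℝ)) ^ 2
    rw [pow_two]
    exact Submodule.mul_mem_mul ⟨u, rfl⟩ ⟨v, rfl⟩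
  let W : (Fin p → ℝ) →ₗ[ℝ] (Fin p → ℝ) →ₗ[ℝ] P := LinearMap.mk₂ ℝ (fun u v => ⟨_, hmem u v⟩)
    (by intros; ext; simp [add_mul]) (by intros; ext; simp) (by intros; ext; simp [mul_add])
    (by intros; ext; simp)
  let D : (Fin p → ℝ) →ₗ[ℝ] (Fin p → ℝ) →ₗ[ℝ] ℝ := LinearMap.mk₂ ℝ (fun u v => ∑ i, u i * v i)
    (by intros; simp [add_mul, Finset.sum_add_distrib])
    (by intros; simp [Finset.mul_sum, mul_assoc])
    (by intros; simp [mul_add, Finset.sum_add_distrib])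
    (by intros; simp [Finset.mul_sum, mul_left_comm])
  refine ⟨LinearMap.mk₂ ℝ (fun u v => Fin.cons (D u v) (f (E2.mkQ (W u v))))
    ?_ ?_ ?_ ?_, ?_⟩
  · intros; ext i; refine Fin.cases ?_ (fun i => ?_) i <;> simp
  · intros; ext i; refine Fin.cases ?_ (fun i => ?_) i <;> simp
  · intros; ext i; refine Fin.cases ?_ (fun i => ?_) i <;> simp
  · intros; ext i; refine Fin.cases ?_ (fun i => ?_) i <;> simp
  intro u v h
  by_contra! hne
  have hD : ∑ i, u i * v i = 0 := congrFun h 0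
  have hW : f (E2.mkQ (W u v)) = 0 := by
    ext i; exact congrFun h i.succ
  have hW := hf _ hW
  rw [Submodule.mkQ_apply, Submodule.Quotient.mk_eq_zero] at hW
  have hW : ι ℝ u * ι ℝ v ∈ E := hW
  have h0 : ι ℝ u * ι ℝ v = 0 := by
    by_contra h0
    exact hp _ hW h0 v hne.2 (by rw [mul_assoc, ι_sq_zero, mul_zero])
  obtain ⟨c, rfl⟩ := wedge_zero u v h0 hne.2
  have hc : c * ∑ i, v i * v i = 0 := by
    rw [Finset.mul_sum, ← hD]; simp [mul_assoc]
  rcases mul_eq_zero.1 hc with hc | hc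
  · exact hne.1 (by simp [hc])
  · apply hne.2
    rw [Finset.sum_eq_zero_iff_of_nonneg (fun i _ => mul_self_nonneg _)] at hc
    ext i; simpa using hc i (Finset.mem_univ _)

section PolyPart

open Polynomial

theorem odd_root (p : ℝ[X]) (hp : Odd p.natDegree) (hm : p.Monic) : ∃ x, p.IsRoot x := by
  have hdeg : 0 < p.degree := by
    rw [← natDegree_pos_iff_degree_pos]; exact hp.pos
  have h1 : Filter.Tendsto (fun x => p.eval x) Filter.atTop Filter.atTop :=
    p.tendsto_atTop_of_leadingCoeff_nonneg hdeg (by rw [hm.leadingCoeff]; exact zero_le_one)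
  have hq : Filter.Tendsto (fun x => (-(p.comp (-X))).eval x) Filter.atTop Filter.atTop := by
    apply tendsto_atTop_of_leadingCoeff_nonneg
    · rw [degree_neg, ← natDegree_pos_iff_degree_pos, natDegree_comp]
      simpa using hp.pos
    · rw [leadingCoeff_neg, leadingCoeff_comp (by simp)]
      simp [hm.leadingCoeff, hp.neg_one_pow]
  obtain ⟨x, hx⟩ := (h1.eventually_ge_atTop 0).exists
  obtain ⟨y, hy⟩ := (hq.eventually_ge_atTop 0).exists
  simp at hy
  have := mem_range_of_exists_le_of_exists_ge (c := 0) p.continuous ⟨-y, hy⟩ ⟨x, hx⟩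
  exact this

theorem odd_common_eigen {I : Type*} (d : ℕ) : ∀ (E : Type) [AddCommGroup E] [Module ℝ E]
    [FiniteDimensional ℝ E] (T : I → Module.End ℝ E) (_ : ∀ i j, T i * T j = T j * T i)
    (_ : Module.finrank ℝ E = d) (_ : Odd d), ∃ v : E, v ≠ 0 ∧ ∀ i, ∃ c : ℝ, T i v = c • v := by
  induction d using Nat.strong_induction_on with
  | _ d ih =>
  intro E _ _ _ T hc hd hodd
  by_cases hs : ∀ i, ∃ c : ℝ, ∀ v, T i v = c • v
  · have : Nontrivial E := Module.nontrivial_of_finrank_pos (R := ℝ) (by rw [hd]; exact hodd.pos)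
    obtain ⟨v, hv⟩ := exists_ne (0 : E)
    exact ⟨v, hv, fun i => (hs i).imp fun c h => h v⟩
  push Not at hs
  obtain ⟨i0, hi0⟩ := hs
  obtain ⟨c, hroot⟩ := odd_root (T i0).charpoly (by rw [LinearMap.charpoly_natDegree, hd]; exact hodd)
    (LinearMap.charpoly_monic _)
  have hev : (T i0).HasEigenvalue c := by
    rw [Module.End.hasEigenvalue_iff_isRoot_charpoly]; exact hroot
  set S : Module.End ℝ E := T i0 - algebraMap ℝ _ c with hS
  have hcS : ∀ i v, T i (S v) = S (T i v) := by
    intro i v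
    have := LinearMap.congr_fun (hc i i0) v
    simp at this
    simp [hS, this]
  have key : ∀ W : Submodule ℝ E, (∀ i, ∀ v ∈ W, T i v ∈ W) → Module.finrank ℝ W < d →
      Odd (Module.finrank ℝ W) → ∃ v : E, v ≠ 0 ∧ ∀ i, ∃ c : ℝ, T i v = c • v := by
    intro W hW hlt ho
    obtain ⟨v, hv, h⟩ := ih _ hlt W (fun i => (T i).restrict (hW i)) (by
      intro i j; ext v
      have := LinearMap.congr_fun (hc i j) v
      simpa using this) rfl ho
    refine ⟨v, by simpa using hv, fun i => ?_⟩
    obtain ⟨c, h⟩ := h i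
    exact ⟨c, by simpa using congrArg Subtype.val h⟩
  have hrn := LinearMap.finrank_range_add_finrank_ker S
  rw [hd] at hrn
  have hker0 : 0 < Module.finrank ℝ (LinearMap.ker S) := by
    obtain ⟨v, hv⟩ := hev.exists_hasEigenvector
    have : v ∈ LinearMap.ker S := by
      simp [hS, hv.apply_eq_smul]
    have : Nontrivial (LinearMap.ker S) := ⟨⟨⟨v, this⟩, 0, by simpa [Subtype.ext_iff] using hv.2⟩⟩
    exact Module.finrank_pos
  have hker1 : Module.finrank ℝ (LinearMap.ker S) < d := by
    rw [← hd]
    apply Submodule.finrank_lt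
    intro h
    obtain ⟨v, hv⟩ := hi0 c
    apply hv
    have : v ∈ LinearMap.ker S := by rw [h]; trivial
    simpa [hS, sub_eq_zero] using this
  rcases Nat.even_or_odd (Module.finrank ℝ (LinearMap.ker S)) with he | ho
  · refine key (LinearMap.range S) ?_ (by omega) ?_
    · rintro i _ ⟨w, rfl⟩
      exact ⟨T i w, (hcS i w).symm⟩
    · rw [← hrn] at hodd
      exact (Nat.odd_add.1 hodd).2 he
  · refine key (LinearMap.ker S) ?_ hker1 ho
    intro i v hv
    rw [LinearMap.mem_ker] at hv ⊢
    rw [← hcS, hv, map_zero]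

theorem vand_odd (n : ℕ) (hn : 1 ≤ n) (h : ∀ k, 0 < k → k < n → Even (n.choose k)) :
    Odd ((n - 1 + n).choose n) := by
  rw [add_comm, Nat.add_choose_eq, ← Finset.add_sum_erase (a := (n, 0)) _ _ (by simp)]
  refine Odd.add_even (by simp) ?_
  apply Finset.even_sum
  rintro ⟨i, j⟩ hij
  rw [Finset.mem_erase, Finset.HasAntidiagonal.mem_antidiagonal, ne_eq, Prod.mk.injEq] at hij
  obtain ⟨hne, hs⟩ := hij
  dsimp only at hs ⊢
  rcases Nat.eq_zero_or_pos i with rfl | hp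
  · have : j = n := by omega
    subst this
    simp only [Nat.choose_eq_zero_of_lt (show j - 1 < j by omega), mul_zero, Even.zero]
  · exact (h i hp (by omega)).mul_right _

noncomputable def ell (a t : ℕ) : Module.Dual ℝ (Fin (a + 1) → ℝ) :=
  ∑ j : Fin (a + 1), ((t : ℝ) ^ (j : ℕ)) • LinearMap.proj j

theorem ell_apply (a t : ℕ) (u : Fin (a + 1) → ℝ) :
    ell a t u = ∑ j : Fin (a + 1), (t : ℝ) ^ (j : ℕ) * u j := by
  simp [ell]

theorem ell_gp (a : ℕ) (S : Finset ℕ) (hS : S.card = a + 1) (u : Fin (a + 1) → ℝ)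
    (h : ∀ t ∈ S, ell a t u = 0) : u = 0 := by
  apply Matrix.eq_zero_of_forall_index_sum_pow_mul_eq_zero
    (f := fun r : Fin (a + 1) => ((S.orderEmbOfFin hS r : ℕ) : ℝ))
  · intro i j hij
    simpa using hij
  · intro j
    rw [← ell_apply]
    exact h _ (Finset.orderEmbOfFin_mem _ _ _)

theorem ell_span (a : ℕ) (S : Finset ℕ) (hS : S.card = a + 1)
    (x : Module.Dual ℝ (Fin (a + 1) → ℝ)) : x ∈ Submodule.span ℝ (ell a '' S) := by
  have := mem_span_of_iInf_ker_le_ker (L := fun t : S => ell a t) (K := x) (by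
    intro u hu
    have : u = 0 := ell_gp a S hS u (by
      intro t ht
      simp only [Submodule.mem_iInf, LinearMap.mem_ker] at hu
      exact hu ⟨t, ht⟩)
    simp [this])
  have e : ell a '' S = Set.range fun t : S => ell a t := by ext; simp
  rw [e]; exact this

theorem ell_pt (a : ℕ) (A : Finset ℕ) (hA : A.card = a) :
    ∃ u : Fin (a + 1) → ℝ, ∀ t, ell a t u = 0 ↔ t ∈ A := by
  let p : ℝ[X] := ∏ s ∈ A, (X - C (s : ℝ))
  refine ⟨fun j => p.coeff j, fun t => ?_⟩
  have h1 : ell a t (fun j => p.coeff j) = p.eval (t : ℝ) := by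
    rw [ell_apply, eval_eq_sum_range' (n := a + 1), Finset.sum_range]
    · simp [mul_comm]
    · have : p.natDegree = a := by
        rw [natDegree_prod_of_monic _ _ (fun s _ => monic_X_sub_C _)]
        simp only [natDegree_X_sub_C, Finset.sum_const, hA, smul_eq_mul, mul_one]
      omega
  rw [h1]
  simp only [p, eval_prod, Finset.prod_eq_zero_iff, eval_sub, eval_X, eval_C, sub_eq_zero]
  constructor
  · rintro ⟨s, hs, h⟩
    have : t = s := by exact_mod_cast h
    rwa [this]
  · intro h; exact ⟨t, h, rfl⟩

noncomputable def pr (a : ℕ) (K : Finset ℕ) : (Fin (a + 1) → ℝ) → ℝ := fun u => ∏ t ∈ K, ell a t u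

def co (a : ℕ) : Module.Dual ℝ (Fin (a + 1) → ℝ) →ₗ[ℝ] ((Fin (a + 1) → ℝ) → ℝ) where
  toFun x := x
  map_add' _ _ := rfl
  map_smul' _ _ := rfl

theorem co_apply (a : ℕ) (x : Module.Dual ℝ (Fin (a + 1) → ℝ)) (u) : co a x u = x u := rfl

noncomputable def S1 (a : ℕ) : Submodule ℝ ((Fin (a + 1) → ℝ) → ℝ) := LinearMap.range (co a)

theorem prod_mem_S1 (a : ℕ) {I : Type*} (s : Finset I) (f : I → Module.Dual ℝ (Fin (a + 1) → ℝ)) :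
    (∏ i ∈ s, co a (f i)) ∈ S1 a ^ s.card := by
  classical
  induction s using Finset.induction_on with
  | empty => simp
  | insert i s hi ih =>
    rw [Finset.prod_insert hi, Finset.card_insert_of_notMem hi, pow_succ']
    exact Submodule.mul_mem_mul ⟨_, rfl⟩ ih

theorem pr_eq (a : ℕ) (K : Finset ℕ) : pr a K = ∏ t ∈ K, co a (ell a t) := by
  ext u; simp [pr, co_apply]

theorem span_pr (a b : ℕ) : S1 a ^ b ≤
    Submodule.span ℝ (pr a '' (Finset.powersetCard b (Finset.range (a + b)))) := by
  induction b with
  | zero =>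
    rw [pow_zero, Submodule.one_le]
    apply Submodule.subset_span
    refine ⟨∅, by simp, by ext; simp [pr]⟩
  | succ b ih =>
    rw [pow_succ', Submodule.mul_le]
    rintro _ ⟨x, rfl⟩ q hq
    have hq := ih hq
    set W := Submodule.span ℝ (pr a '' (Finset.powersetCard (b + 1) (Finset.range (a + (b + 1)))))
    suffices h : Submodule.span ℝ (pr a '' (Finset.powersetCard b (Finset.range (a + b)))) ≤
        W.comap (LinearMap.mulLeft ℝ (co a x)) from h hq
    rw [Submodule.span_le]
    rintro _ ⟨B, hB, rfl⟩
    simp only [Finset.mem_coe, Finset.mem_powersetCard] at hB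
    have hBs : B ⊆ Finset.range (a + (b + 1)) := hB.1.trans (Finset.range_mono (by omega))
    have hx := ell_span a (Finset.range (a + (b + 1)) \ B) (by
      rw [Finset.card_sdiff_of_subset hBs, hB.2]; simp; omega) x
    suffices h : Submodule.span ℝ (ell a '' (Finset.range (a + (b + 1)) \ B : Finset ℕ)) ≤
        W.comap (LinearMap.mulRight ℝ (pr a B) ∘ₗ co a) from h hx
    rw [Submodule.span_le]
    rintro _ ⟨t, ht, rfl⟩
    apply Submodule.subset_span
    have ht : t ∈ Finset.range (a + (b + 1)) ∧ t ∉ B := by simpa using ht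
    refine ⟨insert t B, ?_, ?_⟩
    · simp only [Finset.mem_coe, Finset.mem_powersetCard]
      exact ⟨Finset.insert_subset ht.1 hBs, by rw [Finset.card_insert_of_notMem ht.2, hB.2]⟩
    · ext u; simp [pr, Finset.prod_insert ht.2, co_apply]

theorem pts (a b : ℕ) (B : Finset ℕ) (hB : B ∈ Finset.powersetCard b (Finset.range (a + b))) :
    ∃ u, (∀ t, ell a t u = 0 ↔ t ∈ Finset.range (a + b) \ B) ∧
      ∀ B' ∈ Finset.powersetCard b (Finset.range (a + b)), (pr a B' u ≠ 0 ↔ B' = B) := by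
  rw [Finset.mem_powersetCard] at hB
  obtain ⟨u, hu⟩ := ell_pt a (Finset.range (a + b) \ B) (by
    rw [Finset.card_sdiff_of_subset hB.1, hB.2]; simp)
  refine ⟨u, hu, fun B' hB' => ?_⟩
  rw [Finset.mem_powersetCard] at hB'
  rw [pr, Finset.prod_ne_zero_iff]
  constructor
  · intro h
    apply Finset.eq_of_subset_of_card_le _ (by omega)
    intro t ht
    have := h t ht
    rw [Ne, hu] at this
    by_contra hc
    exact this (Finset.mem_sdiff.2 ⟨hB'.1 ht, hc⟩)
  · rintro rfl t ht h
    rw [hu] at h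
    simp [ht] at h

theorem pr_indep (a b : ℕ) : LinearIndependent ℝ
    (fun B : {B // B ∈ Finset.powersetCard b (Finset.range (a + b))} => pr a B.1) := by
  rw [Fintype.linearIndependent_iff]
  intro g hg B
  obtain ⟨u, -, hu⟩ := pts a b B.1 B.2
  have h := congrFun hg u
  rw [Finset.sum_apply, Finset.sum_eq_single B] at h
  · simpa [(hu B.1 B.2).2 rfl] using h
  · intro B' _ hne
    have : pr a B'.1 u = 0 := by
      by_contra hc
      exact hne (Subtype.ext ((hu _ B'.2).1 hc))
    simp [this]
  · simp

theorem mnr_mem (a b : ℕ) (H : Fin (b + 1) → Fin (b + 1) → Module.Dual ℝ (Fin (a + 1) → ℝ)) :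
    (fun u => Matrix.det (Matrix.of fun r c => H r c u)) ∈ S1 a ^ (b + 1) := by
  have : (fun u => Matrix.det (Matrix.of fun r c => H r c u)) =
      ∑ σ : Equiv.Perm (Fin (b + 1)), ((Equiv.Perm.sign σ : ℤ) : ℝ) • ∏ i, co a (H (σ i) i) := by
    ext u
    rw [Matrix.det_apply']
    simp [co_apply]
  rw [this]
  apply Submodule.sum_mem
  intro σ _
  apply Submodule.smul_mem
  have := prod_mem_S1 a Finset.univ (fun i => H (σ i) i)
  simpa using this

theorem eval_lemma (a b : ℕ) (φ : ((Fin (a + 1) → ℝ) → ℝ) →ₗ[ℝ] ℝ)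
    (x0 : Module.Dual ℝ (Fin (a + 1) → ℝ)) (c : Module.Dual ℝ (Fin (a + 1) → ℝ) →ₗ[ℝ] ℝ)
    (h : ∀ x, ∀ q ∈ S1 a ^ b, φ (co a x * q) = c x * φ (co a x0 * q)) :
    ∃ u, ∀ w ∈ S1 a ^ (b + 1), φ w = φ (co a x0 ^ (b + 1)) * w u := by
  obtain ⟨u, hu⟩ := (Module.evalEquiv ℝ (Fin (a + 1) → ℝ)).surjective c
  have hu' : ∀ x, x u = c x := by intro x; rw [← hu]; rfl
  refine ⟨u, ?_⟩
  suffices H : ∀ j, j ≤ b + 1 → ∀ q ∈ S1 a ^ j, φ (co a x0 ^ (b + 1 - j) * q) =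
      φ (co a x0 ^ (b + 1)) * q u by
    intro w hw
    simpa using H (b + 1) le_rfl w hw
  intro j
  induction j with
  | zero =>
    intro _ q hq
    rw [pow_zero, Submodule.mem_one] at hq
    obtain ⟨y, rfl⟩ := hq
    have : co a x0 ^ (b + 1 - 0) * algebraMap ℝ _ y = y • co a x0 ^ (b + 1) := by
      rw [mul_comm, Algebra.smul_def]; simp
    rw [this, map_smul]
    simp [mul_comm]
  | succ j ih =>
    intro hj q hq
    rw [pow_succ'] at hq
    refine Submodule.mul_induction_on hq ?_ ?_
    · rintro _ ⟨x, rfl⟩ q' hq'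
      have hmem : co a x0 ^ (b - j) * q' ∈ S1 a ^ b := by
        have : S1 a ^ b = S1 a ^ (b - j) * S1 a ^ j := by rw [← pow_add]; congr 1; omega
        rw [this]
        exact Submodule.mul_mem_mul (Submodule.pow_mem_pow _ (LinearMap.mem_range_self _ _) _) hq'
      have e1 : co a x0 ^ (b + 1 - (j + 1)) * (co a x * q') = co a x * (co a x0 ^ (b - j) * q') := by
        rw [Nat.add_sub_add_right]; ring
      have e2 : co a x0 * (co a x0 ^ (b - j) * q') = co a x0 ^ (b + 1 - j) * q' := by
        rw [← mul_assoc, ← pow_succ', show b - j + 1 = b + 1 - j by omega]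
      rw [e1, h _ _ hmem, e2, ih (by omega) q' hq', ← hu', Pi.mul_apply, co_apply]
      ring
    · intro q1 q2 h1 h2
      rw [mul_add, map_add, h1, h2, Pi.add_apply]; ring

theorem coords {W 𝒦 : Type*} [AddCommGroup W] [Module ℝ W] [Fintype 𝒦] [DecidableEq 𝒦]
    (bas : 𝒦 → W) (hb : LinearIndependent ℝ bas) :
    ∃ θ : W →ₗ[ℝ] (𝒦 → ℝ), (∀ k, θ (bas k) = Pi.single k 1) ∧
      ∀ w ∈ Submodule.span ℝ (Set.range bas), w = ∑ k, θ w k • bas k := by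
  have hinj : LinearMap.ker (Fintype.linearCombination ℝ bas) = ⊥ := by
    rw [LinearMap.ker_eq_bot, injective_iff_map_eq_zero]
    intro g hg
    rw [Fintype.linearCombination_apply] at hg
    exact funext (Fintype.linearIndependent_iff.1 hb g hg)
  obtain ⟨θ, hθ⟩ := LinearMap.exists_leftInverse_of_injective _ hinj
  have hθ' : ∀ c, θ (Fintype.linearCombination ℝ bas c) = c := fun c => LinearMap.congr_fun hθ c
  refine ⟨θ, fun k => ?_, fun w hw => ?_⟩
  · have := hθ' (Pi.single k 1)
    rwa [Fintype.linearCombination_apply_single, one_smul] at this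
  · rw [← Fintype.range_linearCombination ℝ bas] at hw
    obtain ⟨c, rfl⟩ := hw
    rw [hθ', Fintype.linearCombination_apply]

theorem vec_poly {U : Type*} (m : ℕ) (θ : (U → ℝ) →ₗ[ℝ] ℝ)
    (A B : U → Matrix (Fin m) (Fin m) ℝ) :
    ∃ q : ℝ[X], ∀ τ : ℝ, θ (fun u => (τ • A u + B u).det) = q.eval τ := by
  let P : U → ℝ[X] := fun u => Matrix.det ((X : ℝ[X]) • (A u).map C + (B u).map C)
  have hdeg : ∀ u, (P u).natDegree < m + 1 := by
    intro u
    have := natDegree_det_X_add_C_le (A u) (B u)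
    simp at this
    exact Nat.lt_succ_of_le this
  have hev : ∀ τ : ℝ, (fun u => (τ • A u + B u).det) =
      ∑ s ∈ Finset.range (m + 1), τ ^ s • (fun u => (P u).coeff s) := by
    intro τ
    ext u
    have h1 : (P u).eval τ = (τ • A u + B u).det := by
      rw [← coe_evalRingHom, RingHom.map_det]
      congr 1
      ext i j
      simp
      exact mul_comm _ _
    rw [← h1, eval_eq_sum_range' (hdeg u), Finset.sum_apply]
    refine Finset.sum_congr rfl fun s _ => ?_
    rw [Pi.smul_apply, smul_eq_mul, mul_comm]
  refine ⟨∑ s ∈ Finset.range (m + 1), C (θ (fun u => (P u).coeff s)) * X ^ s, fun τ => ?_⟩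
  rw [hev, map_sum, eval_finsetSum]
  refine Finset.sum_congr rfl fun s _ => ?_
  rw [map_smul, eval_mul, eval_C, eval_pow, eval_X, smul_eq_mul, mul_comm]

/-- index types -/
abbrev BB (a b : ℕ) : Type := {B : Finset ℕ // B ∈ Finset.powersetCard b (Finset.range (a + b))}
abbrev JJ (a b : ℕ) : Type :=
  {J : Finset ℕ // J ∈ Finset.powersetCard (b + 1) (Finset.range (a + b))}

noncomputable def MM (a b : ℕ) (i : ℕ) (c : Fin (b + 1)) : Module.Dual ℝ (Fin (a + 1) → ℝ) :=
  ((i : ℝ) ^ (c : ℕ)) • ell a i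

noncomputable def HH (a b : ℕ) (G : ℕ → Fin (b + 1) → Module.Dual ℝ (Fin (a + 1) → ℝ)) (τ : ℝ)
    (i : ℕ) (c : Fin (b + 1)) : Module.Dual ℝ (Fin (a + 1) → ℝ) :=
  τ • (G i c - MM a b i c) + MM a b i c

def eJ {a b : ℕ} (J : JJ a b) : Fin (b + 1) → ℕ :=
  J.1.orderEmbOfFin (Finset.mem_powersetCard.1 J.2).2

noncomputable def Dl (a b : ℕ) (G : ℕ → Fin (b + 1) → Module.Dual ℝ (Fin (a + 1) → ℝ)) (τ : ℝ)
    (J : JJ a b) : (Fin (a + 1) → ℝ) → ℝ :=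
  fun u => Matrix.det (Matrix.of fun r c => HH a b G τ (eJ J r) c u)

noncomputable def bas (a b : ℕ) : BB a b ⊕ JJ a b → ((Fin (a + 1) → ℝ) → ℝ) :=
  Sum.elim (fun B => co a (ell a (a + b)) * pr a B.1) (fun J => pr a J.1)

noncomputable def vec (a b : ℕ) (G : ℕ → Fin (b + 1) → Module.Dual ℝ (Fin (a + 1) → ℝ)) (τ : ℝ) :
    BB a b ⊕ JJ a b → ((Fin (a + 1) → ℝ) → ℝ) :=
  Sum.elim (fun B => co a (ell a (a + b)) * pr a B.1) (fun J => Dl a b G τ J)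

theorem notMem_B {a b : ℕ} (B : BB a b) : a + b ∉ B.1 := by
  intro h
  have := (Finset.mem_powersetCard.1 B.2).1 h
  simp at this

theorem notMem_J {a b : ℕ} (B : JJ a b) : a + b ∉ B.1 := by
  intro h
  have := (Finset.mem_powersetCard.1 B.2).1 h
  simp at this

theorem insert_pr {a b : ℕ} (B : BB a b) :
    pr a (insert (a + b) B.1) = co a (ell a (a + b)) * pr a B.1 := by
  ext u; simp [pr, Finset.prod_insert (notMem_B B), co_apply]

def toK (a b : ℕ) : BB a b ⊕ JJ a b → BB a (b + 1) :=
  Sum.elim (fun B => ⟨insert (a + b) B.1, by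
      have h := Finset.mem_powersetCard.1 B.2
      rw [Finset.mem_powersetCard, Finset.card_insert_of_notMem (notMem_B B), h.2]
      exact ⟨Finset.insert_subset (by simp) (h.1.trans (Finset.range_mono (by omega))), rfl⟩⟩)
    (fun J => ⟨J.1, by
      have h := Finset.mem_powersetCard.1 J.2
      rw [Finset.mem_powersetCard]
      exact ⟨h.1.trans (Finset.range_mono (by omega)), h.2⟩⟩)

theorem bas_eq (a b : ℕ) : bas a b = (fun K : BB a (b + 1) => pr a K.1) ∘ toK a b := by
  funext k
  rcases k with B | J
  · simp [bas, toK, insert_pr]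
  · simp [bas, toK]

theorem bas_indep (a b : ℕ) : LinearIndependent ℝ (bas a b) := by
  rw [bas_eq]
  apply (pr_indep a (b + 1)).comp
  rintro (B | J) (B' | J') h
  · simp only [toK, Sum.elim_inl, Subtype.mk.injEq] at h
    congr 1
    ext1
    rw [← Finset.erase_insert (notMem_B B), ← Finset.erase_insert (notMem_B B'), h]
  · exfalso
    simp only [toK, Sum.elim_inl, Sum.elim_inr, Subtype.mk.injEq] at h
    exact notMem_J J' (h ▸ Finset.mem_insert_self _ _)
  · exfalso
    simp only [toK, Sum.elim_inl, Sum.elim_inr, Subtype.mk.injEq] at h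
    exact notMem_J J (h ▸ Finset.mem_insert_self _ _)
  · simp only [toK, Sum.elim_inr, Subtype.mk.injEq] at h
    congr 1
    ext1
    exact h

theorem bas_span (a b : ℕ) : S1 a ^ (b + 1) ≤ Submodule.span ℝ (Set.range (bas a b)) := by
  refine (span_pr a (b + 1)).trans (Submodule.span_mono ?_)
  rintro _ ⟨K, hK, rfl⟩
  have hK := Finset.mem_powersetCard.1 hK
  by_cases h : a + b ∈ K
  · have hB : K.erase (a + b) ∈ Finset.powersetCard b (Finset.range (a + b)) := by
      rw [Finset.mem_powersetCard, Finset.card_erase_of_mem h, hK.2]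
      refine ⟨fun t ht => ?_, rfl⟩
      rw [Finset.mem_erase] at ht
      have := hK.1 ht.2
      simp at this ⊢
      omega
    refine ⟨Sum.inl ⟨_, hB⟩, ?_⟩
    have := insert_pr (⟨_, hB⟩ : BB a b)
    rw [Finset.insert_erase h] at this
    rw [this]; rfl
  · refine ⟨Sum.inr ⟨K, ?_⟩, rfl⟩
    rw [Finset.mem_powersetCard]
    refine ⟨fun t ht => ?_, hK.2⟩
    have h1 := hK.1 ht
    have : t ≠ a + b := by rintro rfl; exact h ht
    simp at h1 ⊢
    omega

theorem pr_mem (a : ℕ) (K : Finset ℕ) : pr a K ∈ S1 a ^ K.card := by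
  rw [pr_eq]; exact prod_mem_S1 a K _

theorem copr_mem (a b : ℕ) (x) (B : BB a b) : co a x * pr a B.1 ∈ S1 a ^ (b + 1) := by
  rw [pow_succ']
  have := pr_mem a B.1
  rw [(Finset.mem_powersetCard.1 B.2).2] at this
  exact Submodule.mul_mem_mul ⟨_, rfl⟩ this

theorem vec_mem (a b : ℕ) (G) (τ : ℝ) (k) : vec a b G τ k ∈ S1 a ^ (b + 1) := by
  rcases k with B | J
  · exact copr_mem a b _ B
  · exact mnr_mem a b fun r c => HH a b G τ (eJ J r) c

theorem Dl_zero (a b : ℕ) (G) (J : JJ a b) : ∃ d : ℝ, d ≠ 0 ∧ Dl a b G 0 J = d • pr a J.1 := by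
  refine ⟨(Matrix.vandermonde fun r => ((eJ J r : ℕ) : ℝ)).det, ?_, ?_⟩
  · rw [Matrix.det_vandermonde_ne_zero_iff]
    intro r s h
    simpa [eJ] using h
  · ext u
    have : (Matrix.of fun r c => HH a b G 0 (eJ J r) c u) =
        Matrix.of fun r c => ell a (eJ J r) u * Matrix.vandermonde (fun r => ((eJ J r : ℕ) : ℝ)) r c := by
      ext r c
      simp [HH, MM, mul_comm, Matrix.vandermonde_apply]
    rw [Dl, this, Matrix.det_mul_column]
    have h2 : ∏ r, ell a (eJ J r) u = pr a J.1 u := by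
      rw [pr, ← Finset.map_orderEmbOfFin_univ J.1 (Finset.mem_powersetCard.1 J.2).2, Finset.prod_map]
      rfl
    rw [h2, mul_comm]; rfl

theorem setup (a b : ℕ) (G : ℕ → Fin (b + 1) → Module.Dual ℝ (Fin (a + 1) → ℝ)) :
    ∃ (Lp : Matrix (BB a b ⊕ JJ a b) (BB a b ⊕ JJ a b) ℝ[X])
      (θ : ((Fin (a + 1) → ℝ) → ℝ) →ₗ[ℝ] (BB a b ⊕ JJ a b → ℝ)),
      (∀ w ∈ S1 a ^ (b + 1), w = ∑ k, θ w k • bas a b k) ∧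
      (∀ τ k j, θ (vec a b G τ k) j = (Lp j k).eval τ) ∧
      Lp.det.eval 0 ≠ 0 := by
  obtain ⟨θ, h1, h2⟩ := coords (bas a b) (bas_indep a b)
  have h3 : ∀ k j, ∃ q : ℝ[X], ∀ τ, θ (vec a b G τ k) j = q.eval τ := by
    intro k j
    rcases k with B | J
    · exact ⟨C (θ (bas a b (Sum.inl B)) j), fun τ => by simp [vec, bas]⟩
    · obtain ⟨q, hq⟩ := vec_poly (b + 1) (LinearMap.proj j ∘ₗ θ)
        (fun u => Matrix.of fun r c => (G (eJ J r) c - MM a b (eJ J r) c) u)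
        (fun u => Matrix.of fun r c => MM a b (eJ J r) c u)
      refine ⟨q, fun τ => ?_⟩
      rw [← hq]
      simp only [LinearMap.comp_apply, LinearMap.proj_apply]
      congr 2
  choose q hq using h3
  refine ⟨Matrix.of fun j k => q k j, θ, fun w hw => h2 w (bas_span a b hw), ?_, ?_⟩
  · intro τ k j; rw [hq]; rfl
  · have : ∀ k, ∃ d : ℝ, d ≠ 0 ∧ vec a b G 0 k = d • bas a b k := by
      rintro (B | J)
      · exact ⟨1, one_ne_zero, by simp [vec, bas]⟩
      · exact Dl_zero a b G J
    choose d hd hd' using this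
    rw [← coe_evalRingHom, RingHom.map_det]
    have : (evalRingHom (0 : ℝ)).mapMatrix (Matrix.of fun j k => q k j) = Matrix.diagonal d := by
      ext j k
      simp only [RingHom.mapMatrix_apply, Matrix.map_apply, Matrix.of_apply, coe_evalRingHom]
      rw [← hq, hd', map_smul, h1, Matrix.diagonal_apply]
      by_cases h : j = k
      · subst h; simp
      · simp [h]
    rw [this, Matrix.det_diagonal]
    exact Finset.prod_ne_zero_iff.2 fun k _ => hd k

theorem deriv_form {X : Type*} [NormedAddCommGroup X] [NormedSpace ℝ X] {I : Type*} [Fintype I]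
    (t : X →L[ℝ] ℝ) (A M v : I → X →L[ℝ] ℝ) (p0 : X) (h0 : t p0 = 0) :
    ∃ F' : X →L[ℝ] ℝ,
      HasStrictFDerivAt (fun p : X => ∑ c, (t p * A c p + M c p) * v c p) F' p0 ∧
      ∀ q, t q = 0 → F' q = ∑ c, (M c p0 * v c q + M c q * v c p0) := by
  have h := HasStrictFDerivAt.fun_sum (x := p0) (u := Finset.univ)
      (A := fun c (p : X) => (t p * A c p + M c p) * v c p)
      (fun c _ => (((t.hasStrictFDerivAt).mul (A c).hasStrictFDerivAt).add
        (M c).hasStrictFDerivAt).mul (v c).hasStrictFDerivAt)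
  refine ⟨_, h, fun q hq => ?_⟩
  rw [sum_apply]
  refine Finset.sum_congr rfl fun c _ => ?_
  simp [h0, hq]
  ring

theorem local_zero (a b : ℕ) (G : ℕ → Fin (b + 1) → Module.Dual ℝ (Fin (a + 1) → ℝ))
    (B : BB a b) (u : Fin (a + 1) → ℝ) (hu : ∀ t, ell a t u = 0 ↔ t ∈ Finset.range (a + b) \ B.1)
    (W : Set (Fin (a + 1) → ℝ)) (hW : W ∈ nhds u) :
    ∀ᶠ τ in nhds (0 : ℝ), ∃ u' ∈ W, ell a (a + b) u' = ell a (a + b) u ∧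
      ∃ v : Fin (b + 1) → ℝ, v ≠ 0 ∧ ∀ i < a + b, ∑ c, HH a b G τ i c u' * v c = 0 := by
  have hB := Finset.mem_powersetCard.1 B.2
  obtain ⟨v, hv⟩ := ell_pt b B.1 hB.2
  have hMM : ∀ i (u : Fin (a + 1) → ℝ) (v : Fin (b + 1) → ℝ),
      ∑ c, MM a b i c u * v c = ell a i u * ell b i v := by
    intro i u v
    rw [ell_apply b, Finset.mul_sum]
    refine Finset.sum_congr rfl fun c _ => ?_
    simp [MM]; ring
  let XX := ℝ × (Fin (a + 1) → ℝ) × (Fin (b + 1) → ℝ)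
  let pτ : XX →L[ℝ] ℝ := ContinuousLinearMap.fst ℝ _ _
  let pu : XX →L[ℝ] (Fin (a + 1) → ℝ) :=
    (ContinuousLinearMap.fst ℝ _ _).comp (ContinuousLinearMap.snd ℝ _ _)
  let pv : XX →L[ℝ] (Fin (b + 1) → ℝ) :=
    (ContinuousLinearMap.snd ℝ _ _).comp (ContinuousLinearMap.snd ℝ _ _)
  let lin : Module.Dual ℝ (Fin (a + 1) → ℝ) → XX →L[ℝ] ℝ := fun x =>
    (LinearMap.toContinuousLinearMap x).comp pu
  let vc : Fin (b + 1) → XX →L[ℝ] ℝ := fun c => (ContinuousLinearMap.proj c).comp pv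
  let y : XX →L[ℝ] ℝ := (LinearMap.toContinuousLinearMap (ell b (a + b))).comp pv
  let p0 : XX := (0, u, v)
  have hF : ∀ i : Fin (a + b), ∃ F' : XX →L[ℝ] ℝ,
      HasStrictFDerivAt (fun p : XX => ∑ c, HH a b G p.1 i c p.2.1 * p.2.2 c) F' p0 ∧
      ∀ du dv, F' (0, du, dv) = ell a i u * ell b i dv + ell a i du * ell b i v := by
    intro i
    obtain ⟨F', h1, h2⟩ := deriv_form pτ (fun c => lin (G i c - MM a b i c))
      (fun c => lin (MM a b i c)) vc p0 rfl
    refine ⟨F', h1, fun du dv => ?_⟩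
    rw [← hMM, ← hMM, ← Finset.sum_add_distrib]
    exact h2 (0, du, dv) rfl
  choose F' hF' hF'' using hF
  let Φ : XX → ℝ × (Fin (a + b) → ℝ) × ℝ × ℝ := fun p =>
    (p.1, (fun i => ∑ c, HH a b G p.1 i c p.2.1 * p.2.2 c), lin (ell a (a + b)) p, y p)
  let Φ' : XX →L[ℝ] ℝ × (Fin (a + b) → ℝ) × ℝ × ℝ :=
    pτ.prod ((ContinuousLinearMap.pi F').prod ((lin (ell a (a + b))).prod y))
  have hΦ : HasStrictFDerivAt Φ Φ' p0 :=
    pτ.hasStrictFDerivAt.prodMk ((hasStrictFDerivAt_pi.2 hF').prodMk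
      ((lin (ell a (a + b))).hasStrictFDerivAt.prodMk y.hasStrictFDerivAt))
  have hinj : Function.Injective Φ' := by
    rw [injective_iff_map_eq_zero]
    rintro ⟨dτ, du, dv⟩ h
    have h1 : dτ = 0 := congrArg Prod.fst h
    subst h1
    have h2 : ∀ i : Fin (a + b), ell a i u * ell b i dv + ell a i du * ell b i v = 0 := by
      intro i
      rw [← hF'']
      exact congrFun (congrArg (fun z => z.2.1) h) i
    have h3 : ell a (a + b) du = 0 := congrArg (fun z => z.2.2.1) h
    have h4 : ell b (a + b) dv = 0 := congrArg (fun z => z.2.2.2) h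
    have h5 : dv = 0 := by
      apply ell_gp b (insert (a + b) B.1) (by rw [Finset.card_insert_of_notMem (notMem_B B), hB.2])
      intro t ht
      rcases Finset.mem_insert.1 ht with rfl | ht
      · exact h4
      · have := h2 ⟨t, by simpa using hB.1 ht⟩
        simp only [(hv t).2 ht, mul_zero, add_zero, mul_eq_zero] at this
        refine this.resolve_left fun hc => ?_
        rw [hu] at hc
        simp [ht] at hc
    have h6 : du = 0 := by
      apply ell_gp a (insert (a + b) (Finset.range (a + b) \ B.1)) (by
        rw [Finset.card_insert_of_notMem (by simp), Finset.card_sdiff_of_subset hB.1, hB.2]; simp)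
      intro t ht
      rcases Finset.mem_insert.1 ht with rfl | ht
      · exact h3
      · have ht' : t < a + b ∧ t ∉ B.1 := by simpa using ht
        have := h2 ⟨t, ht'.1⟩
        simp only [(hu t).2 ht, zero_mul, zero_add, mul_eq_zero] at this
        exact this.resolve_right fun hc => ht'.2 ((hv t).1 hc)
    rw [h5, h6]; rfl
  have hsurj : Φ'.range = ⊤ := by
    rw [LinearMap.range_eq_top]
    refine (LinearMap.injective_iff_surjective_of_finrank_eq_finrank (f := Φ'.toLinearMap) ?_).1 hinj
    simp [XX]; ring
  have hmap := hΦ.map_nhds_eq_of_surj hsurj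
  have hy0 : ell b (a + b) v ≠ 0 := by
    rw [Ne, hv]; exact notMem_B B
  have hp0 : Φ p0 = (0, 0, ell a (a + b) u, ell b (a + b) v) := by
    refine Prod.ext rfl (Prod.ext ?_ rfl)
    funext i
    have : ∑ c, HH a b G 0 i c u * v c = ∑ c, MM a b i c u * v c := by simp [HH]
    show ∑ c, HH a b G 0 i c u * v c = 0
    rw [this, hMM, mul_eq_zero, hu, hv]
    by_cases h : (i : ℕ) ∈ B.1
    · exact Or.inr h
    · left; simp [h]
  have hN : Φ '' {p : XX | p.2.1 ∈ W} ∈ nhds (Φ p0) := by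
    rw [← hmap]
    apply Filter.image_mem_map
    have : Filter.Tendsto (fun p : XX => p.2.1) (nhds p0) (nhds u) :=
      (continuous_fst.comp continuous_snd).tendsto p0
    exact this hW
  rw [hp0] at hN
  have hcont : Filter.Tendsto (fun τ : ℝ => ((τ, 0, ell a (a + b) u, ell b (a + b) v) :
      ℝ × (Fin (a + b) → ℝ) × ℝ × ℝ)) (nhds 0) (nhds (0, 0, ell a (a + b) u, ell b (a + b) v)) :=
    Continuous.tendsto (by fun_prop) 0
  filter_upwards [hcont hN] with τ hτ
  obtain ⟨⟨τ', u', v'⟩, hu', he⟩ := hτ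
  have e1 : τ' = τ := congrArg Prod.fst he
  subst e1
  refine ⟨u', hu', congrArg (fun z => z.2.2.1) he, v', ?_, ?_⟩
  · rintro rfl
    have : ell b (a + b) 0 = ell b (a + b) v := congrArg (fun z => z.2.2.2) he
    rw [map_zero] at this
    exact hy0 this.symm
  · intro i hi
    exact congrFun (congrArg (fun z => z.2.1) he) ⟨i, hi⟩

theorem near_zero (a b : ℕ) (G : ℕ → Fin (b + 1) → Module.Dual ℝ (Fin (a + 1) → ℝ)) :
    ∀ᶠ τ in nhds (0 : ℝ), ∃ pt : BB a b → (Fin (a + 1) → ℝ),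
      (∀ K, ell a (a + b) (pt K) ≠ 0) ∧ (∀ K J, Dl a b G τ J (pt K) = 0) ∧
      (Matrix.of fun K B : BB a b => pr a B.1 (pt K)).det ≠ 0 := by
  have hp := fun B : BB a b => pts a b B.1 B.2
  choose u hu hu' using hp
  have hcont : Continuous fun pt : BB a b → (Fin (a + 1) → ℝ) =>
      (Matrix.of fun K B : BB a b => pr a B.1 (pt K)).det := by
    apply Continuous.matrix_det
    refine continuous_matrix fun K B => ?_
    simp only [Matrix.of_apply, pr]
    refine continuous_finsetProd _ fun t _ => ?_
    exact (LinearMap.continuous_of_finiteDimensional (ell a t)).comp (continuous_apply K)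
  have hdet : (Matrix.of fun K B : BB a b => pr a B.1 (u K)).det ≠ 0 := by
    have : (Matrix.of fun K B : BB a b => pr a B.1 (u K)) =
        Matrix.diagonal fun K => pr a K.1 (u K) := by
      ext K B
      rw [Matrix.of_apply, Matrix.diagonal_apply]
      split_ifs with h
      · rw [h]
      · by_contra hc
        exact h (Subtype.ext ((hu' K B.1 B.2).1 hc)).symm
    rw [this, Matrix.det_diagonal]
    exact Finset.prod_ne_zero_iff.2 fun K _ => (hu' K K.1 K.2).2 rfl
  have hN := hcont.continuousAt.eventually_ne hdet
  rw [nhds_pi, Filter.eventually_iff, Filter.mem_pi'] at hN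
  obtain ⟨I, t, ht, hI⟩ := hN
  have h := Filter.eventually_all.2 fun K => local_zero a b G K (u K) (hu K) (t K) (ht K)
  filter_upwards [h] with τ hτ
  choose pt h1 h2 h3 using hτ
  refine ⟨pt, fun K => ?_, fun K J => ?_, hI fun K _ => h1 K⟩
  · rw [h2, Ne, hu]; simp
  · obtain ⟨v, hv, hv'⟩ := h3 K
    rw [Dl, ← Matrix.exists_mulVec_eq_zero_iff]
    refine ⟨v, hv, ?_⟩
    ext r
    refine hv' (eJ J r) ?_
    have h4 : eJ J r ∈ J.1 := Finset.orderEmbOfFin_mem _ _ _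
    simpa using (Finset.mem_powersetCard.1 J.2).1 h4

theorem fact1 {W 𝒦 : Type*} [AddCommGroup W] [Module ℝ W] [Fintype 𝒦] [DecidableEq 𝒦]
    (bas vec : 𝒦 → W) (L : Matrix 𝒦 𝒦 ℝ) (hv : ∀ k, vec k = ∑ j, L j k • bas j) (c : 𝒦 → ℝ) :
    L.det • ∑ j, c j • bas j = ∑ k, (L.adjugate.mulVec c) k • vec k := by
  have h : L.mulVec (L.adjugate.mulVec c) = L.det • c := by
    rw [Matrix.mulVec_mulVec, Matrix.mul_adjugate, Matrix.smul_mulVec, Matrix.one_mulVec]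
  simp_rw [hv, Finset.smul_sum]
  rw [Finset.sum_comm]
  refine Finset.sum_congr rfl fun j _ => ?_
  have hj : L.mulVec (L.adjugate.mulVec c) j = L.det * c j := congrFun h j
  rw [smul_smul, ← hj, Matrix.mulVec, dotProduct, Finset.sum_smul]
  refine Finset.sum_congr rfl fun k _ => ?_
  rw [smul_smul, mul_comm]

theorem fact2 {𝒦 : Type*} [Fintype 𝒦] [DecidableEq 𝒦] (L : Matrix 𝒦 𝒦 ℝ) (k : 𝒦) (c : 𝒦 → ℝ)
    (hc : ∀ j, c j = L j k) : L.adjugate.mulVec c = L.det • Pi.single k 1 := by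
  have : c = L.mulVec (Pi.single k 1) := by
    ext j; rw [hc]; simp
  rw [this, Matrix.mulVec_mulVec, Matrix.adjugate_mul, Matrix.smul_mulVec, Matrix.one_mulVec]

noncomputable def TT (a b : ℕ) (L : Matrix (BB a b ⊕ JJ a b) (BB a b ⊕ JJ a b) ℝ)
    (θ : ((Fin (a + 1) → ℝ) → ℝ) →ₗ[ℝ] (BB a b ⊕ JJ a b → ℝ))
    (x : Module.Dual ℝ (Fin (a + 1) → ℝ)) : Matrix (BB a b) (BB a b) ℝ :=
  Matrix.of fun B' B => L.adjugate.mulVec (θ (co a x * pr a B.1)) (Sum.inl B')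

theorem comm_local (a b : ℕ) (G : ℕ → Fin (b + 1) → Module.Dual ℝ (Fin (a + 1) → ℝ)) (τ : ℝ)
    (L : Matrix (BB a b ⊕ JJ a b) (BB a b ⊕ JJ a b) ℝ)
    (θ : ((Fin (a + 1) → ℝ) → ℝ) →ₗ[ℝ] (BB a b ⊕ JJ a b → ℝ))
    (h1 : ∀ w ∈ S1 a ^ (b + 1), w = ∑ k, θ w k • bas a b k)
    (h2 : ∀ k j, θ (vec a b G τ k) j = L j k)
    (pt : BB a b → (Fin (a + 1) → ℝ)) (p1 : ∀ K, ell a (a + b) (pt K) ≠ 0)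
    (p2 : ∀ K J, Dl a b G τ J (pt K) = 0)
    (p3 : (Matrix.of fun K B : BB a b => pr a B.1 (pt K)).det ≠ 0)
    (x y : Module.Dual ℝ (Fin (a + 1) → ℝ)) :
    TT a b L θ x * TT a b L θ y = TT a b L θ y * TT a b L θ x := by
  set P := (Matrix.of fun K B : BB a b => pr a B.1 (pt K)) with hP
  have hv : ∀ k, vec a b G τ k = ∑ j, L j k • bas a b j := by
    intro k
    rw [h1 _ (vec_mem a b G τ k)]
    simp_rw [h2]
  have key : ∀ x, P * TT a b L θ x =
      Matrix.diagonal (fun K => L.det * x (pt K) / ell a (a + b) (pt K)) * P := by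
    intro x
    ext K B
    rw [Matrix.diagonal_mul, Matrix.mul_apply]
    have h3 := fact1 (bas a b) (vec a b G τ) L hv (θ (co a x * pr a B.1))
    rw [← h1 _ (copr_mem a b x B)] at h3
    have h4 := congrFun h3 (pt K)
    simp only [Pi.smul_apply, smul_eq_mul, Pi.mul_apply, Finset.sum_apply, Fintype.sum_sum_type,
      vec, Sum.elim_inl, Sum.elim_inr, p2, mul_zero, Finset.sum_const_zero, add_zero, co_apply] at h4
    simp only [hP, Matrix.of_apply, TT]
    rw [div_mul_eq_mul_div, eq_div_iff (p1 K), mul_assoc, h4, Finset.sum_mul]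
    refine Finset.sum_congr rfl fun B' _ => ?_
    ring
  have h5 : P * (TT a b L θ x * TT a b L θ y) = P * (TT a b L θ y * TT a b L θ x) := by
    rw [← Matrix.mul_assoc, key, Matrix.mul_assoc, key, ← Matrix.mul_assoc P, key,
      Matrix.mul_assoc, key, ← Matrix.mul_assoc, ← Matrix.mul_assoc, Matrix.diagonal_mul_diagonal,
      Matrix.diagonal_mul_diagonal]
    congr 2
    ext K
    ring
  have hu : IsUnit P := (Matrix.isUnit_iff_isUnit_det P).2 (isUnit_iff_ne_zero.2 p3)
  exact hu.mul_left_cancel h5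

theorem comm_all (a b : ℕ) (G : ℕ → Fin (b + 1) → Module.Dual ℝ (Fin (a + 1) → ℝ))
    (Lp : Matrix (BB a b ⊕ JJ a b) (BB a b ⊕ JJ a b) ℝ[X])
    (θ : ((Fin (a + 1) → ℝ) → ℝ) →ₗ[ℝ] (BB a b ⊕ JJ a b → ℝ))
    (h1 : ∀ w ∈ S1 a ^ (b + 1), w = ∑ k, θ w k • bas a b k)
    (h2 : ∀ τ k j, θ (vec a b G τ k) j = (Lp j k).eval τ)
    (x y : Module.Dual ℝ (Fin (a + 1) → ℝ)) (τ : ℝ) :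
    TT a b (Lp.map (eval τ)) θ x * TT a b (Lp.map (eval τ)) θ y =
      TT a b (Lp.map (eval τ)) θ y * TT a b (Lp.map (eval τ)) θ x := by
  let Tp : Module.Dual ℝ (Fin (a + 1) → ℝ) → Matrix (BB a b) (BB a b) ℝ[X] := fun x =>
    Matrix.of fun B' B => ∑ k, Lp.adjugate (Sum.inl B') k * C (θ (co a x * pr a B.1) k)
  have hT : ∀ x τ, TT a b (Lp.map (eval τ)) θ x = (evalRingHom τ).mapMatrix (Tp x) := by
    intro x τ
    ext B' B
    have h3 : Lp.map (eval τ) = (evalRingHom τ).mapMatrix Lp := rfl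
    rw [TT, h3, ← RingHom.map_adjugate]
    simp [Tp, Matrix.mulVec, dotProduct, eval_finsetSum]
  have hTp : Tp x * Tp y = Tp y * Tp x := by
    ext1 B' B
    apply Polynomial.eq_of_infinite_eval_eq
    apply infinite_of_mem_nhds (0 : ℝ)
    filter_upwards [near_zero a b G] with τ hτ
    obtain ⟨pt, p1, p2, p3⟩ := hτ
    have h4 := comm_local a b G τ (Lp.map (eval τ)) θ h1 (h2 τ) pt p1 p2 p3 x y
    rw [hT, hT, ← (evalRingHom τ).mapMatrix.map_mul, ← (evalRingHom τ).mapMatrix.map_mul] at h4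
    exact congrFun (congrFun h4 B') B
  rw [hT, hT, ← (evalRingHom τ).mapMatrix.map_mul, ← (evalRingHom τ).mapMatrix.map_mul, hTp]

theorem zero_of_minors (m b : ℕ) (N : ℕ → Fin (b + 1) → ℝ)
    (h : ∀ J : Finset ℕ, ∀ hJ : J.card = b + 1, J ⊆ Finset.range m →
      (Matrix.of fun r c => N (J.orderEmbOfFin hJ r) c).det = 0) :
    ∃ v : Fin (b + 1) → ℝ, v ≠ 0 ∧ ∀ i < m, ∑ c, N i c * v c = 0 := by
  by_contra hc
  push Not at hc
  have hspan : Submodule.span ℝ (Set.range fun i : Fin m => N i) = ⊤ := by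
    by_contra hne
    obtain ⟨f, hf, hf'⟩ := Submodule.exists_le_ker_of_lt_top _ (lt_top_iff_ne_top.2 hne)
    have hfs : ∀ x : Fin (b + 1) → ℝ, f x = ∑ c, x c * f (Pi.single c 1) := by
      intro x
      conv_lhs => rw [pi_eq_sum_univ' x]
      simp
    obtain ⟨i, hi, hi'⟩ := hc (fun c => f (Pi.single c 1)) (by
      intro h0
      apply hf
      ext x
      have := congrFun h0 x
      simpa using this)
    apply hi'
    rw [← hfs]
    exact hf' (Submodule.subset_span ⟨⟨i, hi⟩, rfl⟩)
  obtain ⟨κ, g, hg, hs, hli⟩ := exists_linearIndependent' ℝ fun i : Fin m => N i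
  rw [hspan] at hs
  have : Finite κ := Finite.of_injective g hg
  have := Fintype.ofFinite κ
  have hcard : Fintype.card κ = b + 1 := by
    have h1 := finrank_span_eq_card hli
    rw [hs, finrank_top] at h1
    simpa using h1.symm
  let e : κ ↪ ℕ := ⟨fun k => g k, fun k k' hk => hg (Fin.ext hk)⟩
  let J : Finset ℕ := Finset.univ.map e
  have hJ : J.card = b + 1 := by simp [J, hcard]
  have hmem : ∀ r, ∃ k, e k = J.orderEmbOfFin hJ r := by
    intro r
    have := Finset.orderEmbOfFin_mem J hJ r
    obtain ⟨k, -, hk⟩ := Finset.mem_map.1 this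
    exact ⟨k, hk⟩
  choose s hs' using hmem
  have hsinj : Function.Injective s := by
    intro r r' hr
    apply (J.orderEmbOfFin hJ).injective
    rw [← hs', ← hs', hr]
  have hli2 := hli.comp s hsinj
  have hdet := h J hJ (by
    intro t ht
    simp only [J, Finset.mem_map, Finset.mem_univ, true_and] at ht
    obtain ⟨k, rfl⟩ := ht
    exact Finset.mem_range.2 (g k).2)
  have h6 : LinearIndependent ℝ (Matrix.of fun r c => N (J.orderEmbOfFin hJ r) c).row := by
    have h7 : (Matrix.of fun r c => N (J.orderEmbOfFin hJ r) c).row =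
        ((fun i : Fin m => N i) ∘ g) ∘ s := by
      funext r
      show N (J.orderEmbOfFin hJ r) = N (e (s r))
      rw [hs']
    rw [h7]
    exact hli2
  rw [Matrix.linearIndependent_rows_iff_isUnit, Matrix.isUnit_iff_isUnit_det, hdet] at h6
  simp at h6

theorem zero_generic (a b : ℕ) (hodd : Odd ((a + b).choose b))
    (G : ℕ → Fin (b + 1) → Module.Dual ℝ (Fin (a + 1) → ℝ)) (τ : ℝ)
    (L : Matrix (BB a b ⊕ JJ a b) (BB a b ⊕ JJ a b) ℝ)
    (θ : ((Fin (a + 1) → ℝ) → ℝ) →ₗ[ℝ] (BB a b ⊕ JJ a b → ℝ))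
    (h2 : ∀ k j, θ (vec a b G τ k) j = L j k) (hD : L.det ≠ 0)
    (hcomm : ∀ x y, TT a b L θ x * TT a b L θ y = TT a b L θ y * TT a b L θ x) :
    ∃ u : Fin (a + 1) → ℝ, u ≠ 0 ∧ ∃ v : Fin (b + 1) → ℝ, v ≠ 0 ∧
      ∀ i < a + b, ∑ c, HH a b G τ i c u * v c = 0 := by
  obtain ⟨φ, hφ, hφ'⟩ := odd_common_eigen ((a + b).choose b) (BB a b → ℝ)
    (fun x : Module.Dual ℝ (Fin (a + 1) → ℝ) => Matrix.toLin' (TT a b L θ x).transpose) (by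
      intro x y
      rw [Module.End.mul_eq_comp, Module.End.mul_eq_comp, ← Matrix.toLin'_mul, ← Matrix.toLin'_mul,
        ← Matrix.transpose_mul, ← Matrix.transpose_mul, hcomm]) (by
      rw [Module.finrank_pi, Fintype.card_coe, Finset.card_powersetCard, Finset.card_range]) hodd
  choose c hc using hφ'
  let ψ : ((Fin (a + 1) → ℝ) → ℝ) →ₗ[ℝ] ℝ :=
    ∑ B, φ B • (LinearMap.proj (Sum.inl B) ∘ₗ Matrix.toLin' L.adjugate ∘ₗ θ)
  have hψ : ∀ w, ψ w = ∑ B, φ B * L.adjugate.mulVec (θ w) (Sum.inl B) := by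
    intro w
    simp [ψ]
  have hψx : ∀ x B, ψ (co a x * pr a B.1) = c x * φ B := by
    intro x B
    have h3 := congrFun (hc x) B
    rw [Matrix.toLin'_apply, Pi.smul_apply, smul_eq_mul] at h3
    rw [← h3, hψ]
    refine Finset.sum_congr rfl fun B' _ => ?_
    rw [mul_comm]; rfl
  have hψv : ∀ k, ψ (vec a b G τ k) = ∑ B, φ B * (L.det • Pi.single k 1 : BB a b ⊕ JJ a b → ℝ) (Sum.inl B) := by
    intro k
    rw [hψ, fact2 L k _ (h2 k)]
  have hψ0 : ∀ B : BB a b, ψ (co a (ell a (a + b)) * pr a B.1) = L.det * φ B := by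
    intro B
    have h3 := hψv (Sum.inl B)
    rw [Finset.sum_eq_single B] at h3
    · rw [mul_comm L.det]
      simpa [vec] using h3
    · intro B' _ hB'
      simp [hB']
    · simp
  have hψJ : ∀ J, ψ (Dl a b G τ J) = 0 := by
    intro J
    have h3 := hψv (Sum.inr J)
    simpa [vec] using h3
  obtain ⟨B0, hB0⟩ : ∃ B, φ B ≠ 0 := by
    by_contra hcon
    push Not at hcon
    exact hφ (funext hcon)
  let c' : Module.Dual ℝ (Fin (a + 1) → ℝ) →ₗ[ℝ] ℝ :=
    (L.det * φ B0)⁻¹ • (ψ ∘ₗ LinearMap.mulRight ℝ (pr a B0.1) ∘ₗ co a)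
  have hc' : ∀ x, c' x = c x / L.det := by
    intro x
    have : c' x = (L.det * φ B0)⁻¹ * ψ (co a x * pr a B0.1) := rfl
    rw [this, hψx]
    field_simp
  have hspan : ∀ x, ∀ q ∈ S1 a ^ b, ψ (co a x * q) = c' x * ψ (co a (ell a (a + b)) * q) := by
    intro x q hq
    have hq' := span_pr a b hq
    clear hq
    induction hq' using Submodule.span_induction with
    | mem q hq =>
      obtain ⟨B, hB, rfl⟩ := hq
      have e1 := hψx x ⟨B, hB⟩
      have e2 := hψ0 ⟨B, hB⟩
      dsimp only at e1 e2
      rw [e1, e2, hc']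
      field_simp
    | zero => simp
    | add p q _ _ hp hq => rw [mul_add, mul_add, map_add, map_add, hp, hq]; ring
    | smul r p _ hp =>
      rw [mul_smul_comm, mul_smul_comm, map_smul, map_smul, hp, smul_eq_mul, smul_eq_mul]; ring
  obtain ⟨u, hu⟩ := eval_lemma a b ψ (ell a (a + b)) c' hspan
  have hne := hψ0 B0
  rw [hu _ (copr_mem a b _ B0)] at hne
  have hne' : L.det * φ B0 ≠ 0 := mul_ne_zero hD hB0
  have hκ : ψ (co a (ell a (a + b)) ^ (b + 1)) ≠ 0 := by
    intro h0
    rw [h0, zero_mul] at hne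
    exact hne' hne.symm
  refine ⟨u, ?_, ?_⟩
  · rintro rfl
    apply hne'
    rw [← hne]
    simp [co_apply]
  · apply zero_of_minors (a + b) b (fun i c => HH a b G τ i c u)
    intro J hJ hJ'
    have h3 := hψJ ⟨J, Finset.mem_powersetCard.2 ⟨hJ', hJ⟩⟩
    have h4 := hu _ (vec_mem a b G τ (Sum.inr ⟨J, Finset.mem_powersetCard.2 ⟨hJ', hJ⟩⟩))
    have h3 := h4.symm.trans h3
    exact (mul_eq_zero.1 h3).resolve_left hκ

theorem star (a b : ℕ) (hodd : Odd ((a + b).choose b))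
    (G : ℕ → Fin (b + 1) → Module.Dual ℝ (Fin (a + 1) → ℝ)) :
    ∃ u : Fin (a + 1) → ℝ, u ≠ 0 ∧ ∃ v : Fin (b + 1) → ℝ, v ≠ 0 ∧
      ∀ i < a + b, ∑ c, G i c u * v c = 0 := by
  obtain ⟨Lp, θ, h1, h2, h3⟩ := setup a b G
  let Z : Set (ℝ ×
      (Metric.sphere (0 : Fin (a + 1) → ℝ) 1 × Metric.sphere (0 : Fin (b + 1) → ℝ) 1)) := {p | ∀ i < a + b, ∑ c, HH a b G p.1 i c p.2.1.1 * p.2.2.1 c = 0}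
  have hZ : IsClosed Z := by
    simp only [Z, Set.ofPred_forall]
    refine isClosed_iInter fun i => isClosed_iInter fun _ => isClosed_eq ?_ continuous_const
    refine continuous_finsetSum _ fun c _ => ?_
    have e1 : Continuous fun p : ℝ ×
      (Metric.sphere (0 : Fin (a + 1) → ℝ) 1 × Metric.sphere (0 : Fin (b + 1) → ℝ) 1) => (G i c - MM a b i c) p.2.1.1 :=
      (LinearMap.continuous_of_finiteDimensional _).comp (by fun_prop)
    have e2 : Continuous fun p : ℝ ×
      (Metric.sphere (0 : Fin (a + 1) → ℝ) 1 × Metric.sphere (0 : Fin (b + 1) → ℝ) 1) => (MM a b i c) p.2.1.1 :=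
      (LinearMap.continuous_of_finiteDimensional _).comp (by fun_prop)
    have e3 : Continuous fun p : ℝ ×
      (Metric.sphere (0 : Fin (a + 1) → ℝ) 1 × Metric.sphere (0 : Fin (b + 1) → ℝ) 1) => p.2.2.1 c :=
      (continuous_apply c).comp (continuous_subtype_val.comp (continuous_snd.comp continuous_snd))
    exact ((continuous_fst.mul e1).add e2).mul e3
  have hcl : IsClosed (Prod.fst '' Z) := isClosedMap_fst_of_compactSpace _ hZ
  have hdense : Dense {τ : ℝ | Lp.det.eval τ ≠ 0} := by
    have hfin : {τ : ℝ | Lp.det.eval τ = 0}.Finite := by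
      apply Polynomial.finite_setOfPred_isRoot
      rintro h0
      rw [h0] at h3
      simp at h3
    exact hfin.countable.dense_compl ℝ
  have hsub : {τ : ℝ | Lp.det.eval τ ≠ 0} ⊆ Prod.fst '' Z := by
    intro τ hτ
    have hdet : (Lp.map (eval τ)).det = Lp.det.eval τ := by
      rw [← coe_evalRingHom, RingHom.map_det]; rfl
    obtain ⟨u, hu, v, hv, huv⟩ := zero_generic a b hodd G τ (Lp.map (eval τ)) θ (h2 τ)
      (by rw [hdet]; exact hτ) (fun x y => comm_all a b G Lp θ h1 h2 x y τ)
    refine ⟨(τ, ⟨‖u‖⁻¹ • u, by simp [norm_smul, hu]⟩, ⟨‖v‖⁻¹ • v, by simp [norm_smul, hv]⟩), ?_, rfl⟩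
    intro i hi
    have e := huv i hi
    have : ∑ c, HH a b G τ i c (‖u‖⁻¹ • u) * (‖v‖⁻¹ • v) c =
        (‖u‖⁻¹ * ‖v‖⁻¹) * ∑ c, HH a b G τ i c u * v c := by
      rw [Finset.mul_sum]
      refine Finset.sum_congr rfl fun c _ => ?_
      rw [map_smul, Pi.smul_apply, smul_eq_mul, smul_eq_mul]
      ring
    rw [e, mul_zero] at this
    exact this
  have h1Z : (1 : ℝ) ∈ Prod.fst '' Z := by
    have := hdense.mono hsub
    rw [← hcl.closure_eq, this.closure_eq]
    trivial
  obtain ⟨⟨τ, u, v⟩, hz, rfl⟩ := h1Z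
  refine ⟨u.1, ?_, v.1, ?_, ?_⟩
  · exact ne_zero_of_mem_unit_sphere u
  · exact ne_zero_of_mem_unit_sphere v
  · intro i hi
    have := hz i hi
    simpa [HH] using this

theorem nonsing_even (p a b : ℕ) (ha : a + 1 ≤ p) (hb : b + 1 ≤ p)
    (Q : (Fin p → ℝ) →ₗ[ℝ] (Fin p → ℝ) →ₗ[ℝ] (Fin (a + b) → ℝ))
    (hQ : ∀ u v, Q u v = 0 → u = 0 ∨ v = 0) : ¬ Odd ((a + b).choose b) := by
  intro hodd
  let ext (m : ℕ) : (Fin m → ℝ) →ₗ[ℝ] (Fin p → ℝ) :=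
    LinearMap.pi fun i => if h : (i : ℕ) < m then LinearMap.proj ⟨i, h⟩ else 0
  have hext : ∀ m, m ≤ p → ∀ u : Fin m → ℝ, ext m u = 0 → u = 0 := by
    intro m hm u hu
    funext i
    have := congrFun hu ⟨i, i.2.trans_le hm⟩
    simpa [ext] using this
  obtain ⟨u, hu, v, hv, h⟩ := star a b hodd fun i c =>
    if h : i < a + b then
      LinearMap.proj ⟨i, h⟩ ∘ₗ (Q.flip (ext (b + 1) (Pi.single c 1))) ∘ₗ ext (a + 1) else 0
  have hz : Q (ext (a + 1) u) (ext (b + 1) v) = 0 := by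
    funext i
    have h1 := h i i.2
    simp only [i.2, dif_pos, LinearMap.comp_apply, LinearMap.proj_apply, LinearMap.flip_apply,
      Fin.eta] at h1
    rw [Pi.zero_apply, ← h1]
    conv_lhs => rw [pi_eq_sum_univ' v]
    simp [mul_comm]
  rcases hQ _ _ hz with h0 | h0
  · exact hu (hext _ ha u h0)
  · exact hv (hext _ hb v h0)

end PolyPart

/-- if the maximal dimension `MP(n)` of a prime subspace of `⋀²(ℝⁿ)` equals
`(n−1)(n−2)/2`, then `MP(n+1) = MP(n)`. -/
theorem stmt_8 (n : ℕ) (hn : 4 ≤ n)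
    (hub : ∀ E : Submodule ℝ (ExteriorAlgebra ℝ (Fin n → ℝ)),
      E ≤ ⋀[ℝ]^2 (Fin n → ℝ) → IsPrimeSub E →
        Module.finrank ℝ E ≤ (n - 1) * (n - 2) / 2)
    (hex : ∃ E : Submodule ℝ (ExteriorAlgebra ℝ (Fin n → ℝ)),
      E ≤ ⋀[ℝ]^2 (Fin n → ℝ) ∧ IsPrimeSub E ∧
        Module.finrank ℝ E = (n - 1) * (n - 2) / 2) :
    (∀ E' : Submodule ℝ (ExteriorAlgebra ℝ (Fin (n + 1) → ℝ)),
      E' ≤ ⋀[ℝ]^2 (Fin (n + 1) → ℝ) → IsPrimeSub E' →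
        Module.finrank ℝ E' ≤ (n - 1) * (n - 2) / 2) ∧
    (∃ E' : Submodule ℝ (ExteriorAlgebra ℝ (Fin (n + 1) → ℝ)),
      E' ≤ ⋀[ℝ]^2 (Fin (n + 1) → ℝ) ∧ IsPrimeSub E' ∧
        Module.finrank ℝ E' = (n - 1) * (n - 2) / 2) := by
  have hc1 : ∀ m : ℕ, 2 * m.choose 2 = m * (m - 1) := by
    intro m
    rw [Nat.choose_two_right]
    exact Nat.mul_div_cancel' (Nat.even_mul_pred_self m).two_dvd
  obtain ⟨k, rfl⟩ : ∃ k, n = k + 2 := ⟨n - 2, by omega⟩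
  have hq : (k + 2 - 1) * (k + 2 - 2) / 2 = (k + 1).choose 2 := by
    rw [Nat.choose_two_right]; rfl
  rw [hq] at hub hex ⊢
  have hn1 : (k + 2).choose 2 = (k + 1).choose 2 + (k + 1) := by
    rw [Nat.choose_succ_succ' (k + 1) 1, Nat.choose_one_right, add_comm]
  have hn2 : (k + 2 + 1).choose 2 = (k + 1).choose 2 + (k + 1) + (k + 2) := by
    rw [Nat.choose_succ_succ' (k + 2) 1, Nat.choose_one_right, ← hn1, add_comm]
  obtain ⟨E, hE, hEp, hEd⟩ := hex
  refine ⟨fun E' hE' hp' => ?_, ?_⟩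
  · by_contra hlt
    push Not at hlt
    obtain ⟨Q, hQ⟩ := bilin_of_prime (k + 2) (k + 1) E hE hEp (by rw [hEd, hn1])
    have heven : ∀ j, 0 < j → j < k + 2 → Even ((k + 2).choose j) := by
      intro j h0 h1
      obtain ⟨i, hi⟩ : ∃ i, i + j = k + 1 + 1 := ⟨k + 2 - j, by omega⟩
      rw [← Nat.not_odd_iff_even]
      have gen : ∀ (D : ℕ) (Q : (Fin (k + 2) → ℝ) →ₗ[ℝ] (Fin (k + 2) → ℝ) →ₗ[ℝ] (Fin D → ℝ)),
          (∀ u v, Q u v = 0 → u = 0 ∨ v = 0) → i + j = D → ¬ Odd (D.choose j) := by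
        rintro D Q hQ rfl
        exact nonsing_even (k + 2) i j (by omega) (by omega) Q hQ
      exact gen _ Q hQ hi
    have hodd := vand_odd (k + 2) (by omega) heven
    obtain ⟨Q', hQ'⟩ := bilin_of_prime (k + 2 + 1) (k + 1 + (k + 1)) E' hE' hp' (by omega)
    exact nonsing_even (k + 2 + 1) (k + 1) (k + 2) (by omega) (by omega) Q' hQ' hodd
  · obtain ⟨E', h1, h2, h3⟩ := prime_extend (k + 2) (by omega) E hE hEp
    exact ⟨E', h1, h2, h3.trans hEd⟩
end

section
/- Let n ≥ 4, let MP(n) denote the maximal dimension of a prime subspace of ⋀²(ℝⁿ), and let 1 ≤ s ≤ n. If MP(n) + Σ_{i=1}^{s} (n−i) < n(n−1)/2, then MP(n+1) ≥ MP(n) + s; that is, there exists a prime subspace of ⋀²(ℝ^{n+1}) of dimension at least MP(n) + s. -/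
set_option synthInstance.maxHeartbeats 1000000
set_option maxHeartbeats 1000000

open ExteriorAlgebra

open Module

/-- Zero-extension of a function on a subtype. -/
noncomputable def extZ {n : ℕ} (p : Fin n → Prop) : ({i // p i} → ℝ) →ₗ[ℝ] (Fin n → ℝ) :=
  Function.ExtendByZero.linearMap ℝ Subtype.val

lemma extZ_restrict {n : ℕ} (p : Fin n → Prop) (v : Fin n → ℝ) (h : ∀ i, ¬ p i → v i = 0) :
    extZ p (fun i => v i.1) = v := by
  funext i
  by_cases hi : p i
  · have := Function.Injective.extend_apply (Subtype.val_injective (p := p))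
      (fun i : {i // p i} => v i.1) 0 ⟨i, hi⟩
    simpa [extZ] using this
  · rw [h i hi]
    simp only [extZ, Function.ExtendByZero.linearMap_apply]
    rw [Function.extend_apply']
    · rfl
    · rintro ⟨a, rfl⟩
      exact hi a.2

lemma extZ_inj {n : ℕ} (p : Fin n → Prop) (a : {i // p i} → ℝ) (h : extZ p a = 0) : a = 0 := by
  funext i
  have := Function.Injective.extend_apply (Subtype.val_injective (p := p)) a 0 i
  rw [← this]
  exact congrFun h i.1

lemma extZ_not {n : ℕ} (p : Fin n → Prop) (a : {i // p i} → ℝ) (i : Fin n) (hi : ¬ p i) :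
    extZ p a i = 0 := by
  simp only [extZ, Function.ExtendByZero.linearMap_apply]
  rw [Function.extend_apply']
  · rfl
  · rintro ⟨a, rfl⟩
    exact hi a.2

/-- Choice of a new vector avoiding a low-dimensional family. -/
lemma exists_avoid {n : ℕ} {F : Type*} [AddCommGroup F] [Module ℝ F] [FiniteDimensional ℝ F]
    (B : (Fin n → ℝ) →ₗ[ℝ] (Fin n → ℝ) →ₗ[ℝ] F) (hB : ∀ v, B v v = 0)
    (E : Submodule ℝ F) (T : (Fin n → ℝ) →ₗ[ℝ] F) (k : Fin n)
    (hd : finrank ℝ E + (n - 1) + k < finrank ℝ F) :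
    ∃ w : F, ∀ v : Fin n → ℝ, v k = 1 → (∀ i, k < i → v i = 0) → ∀ A ∈ E, ∀ x,
      T v + w + A ≠ B v x := by
  classical
  let e : F ≃ₗ[ℝ] (Fin (finrank ℝ F) → ℝ) := (finBasis ℝ F).equivFun
  let eE : E ≃ₗ[ℝ] (Fin (finrank ℝ E) → ℝ) := (finBasis ℝ E).equivFun
  let Be := (B.compr₂ e.toLinearMap).toContinuousBilinearMap
  let Te := (e.toLinearMap ∘ₗ T).toContinuousLinearMap
  let Ee := (e.toLinearMap ∘ₗ E.subtype ∘ₗ eE.symm.toLinearMap).toContinuousLinearMap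
  let Lu := (extZ (fun i : Fin n => i < k)).toContinuousLinearMap
  let Lx := (extZ (fun i : Fin n => i ≠ k)).toContinuousLinearMap
  let f : (({i : Fin n // i < k} → ℝ) × ({i : Fin n // i ≠ k} → ℝ) × (Fin (finrank ℝ E) → ℝ)) →
      (Fin (finrank ℝ F) → ℝ) := fun p =>
    Be (Lu p.1 + Pi.single k 1) (Lx p.2.1) - Te (Lu p.1 + Pi.single k 1) - Ee p.2.2
  have hf : ContDiff ℝ 1 f := by
    fun_prop
  have hlt : finrank ℝ (({i : Fin n // i < k} → ℝ) × ({i : Fin n // i ≠ k} → ℝ) ×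
      (Fin (finrank ℝ E) → ℝ)) < finrank ℝ (Fin (finrank ℝ F) → ℝ) := by
    have h1 : Fintype.card {i : Fin n // i < k} = k := by
      rw [Fintype.card_of_subtype (Finset.Iio k) (by simp), Fin.card_Iio]
    have h2 : Fintype.card {i : Fin n // i ≠ k} = n - 1 := by
      rw [Fintype.card_subtype_compl, Fintype.card_fin, Fintype.card_subtype_eq]
    rw [finrank_prod, finrank_prod, finrank_fintype_fun_eq_card, finrank_fintype_fun_eq_card,
      finrank_fin_fun, finrank_fin_fun, h1, h2]
    omega
  obtain ⟨y, hy⟩ := (hf.dense_compl_range_of_finrank_lt_finrank hlt).nonempty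
  refine ⟨e.symm y, fun v hvk hv A hA x h => hy ?_⟩
  refine ⟨(fun i => (v - Pi.single k 1 : Fin n → ℝ) i.1, fun i => (x - x k • v) i.1, eE ⟨A, hA⟩), ?_⟩
  have e1 : Lu (fun i => (v - Pi.single k 1 : Fin n → ℝ) i.1) = v - Pi.single k 1 := by
    refine extZ_restrict _ _ ?_
    intro i hi
    rcases (not_lt.1 hi).eq_or_lt with h | h
    · subst h; simp [hvk]
    · simp [hv i h, h.ne']
  have e2 : Lx (fun i => (x - x k • v) i.1) = x - x k • v := by
    refine extZ_restrict _ _ ?_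
    intro i hi
    rw [not_not] at hi
    subst hi; simp [hvk]
  have e3 : Ee (eE ⟨A, hA⟩) = e A := by simp [Ee]
  simp only [f]
  rw [e1, e2, e3]
  have e4 : Be (v - Pi.single k 1 + Pi.single k 1) (x - x k • v) = e (B v x) := by
    simp [Be, hB]
  have e5 : Te (v - Pi.single k 1 + Pi.single k 1) = e (T v) := by
    simp [Te]
  rw [e4, e5, ← h]
  simp only [map_add, LinearEquiv.apply_symm_apply]
  abel

lemma exists_T {n : ℕ} {F : Type*} [AddCommGroup F] [Module ℝ F] [FiniteDimensional ℝ F]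
    (B : (Fin n → ℝ) →ₗ[ℝ] (Fin n → ℝ) →ₗ[ℝ] F) (hB : ∀ v, B v v = 0)
    (E : Submodule ℝ F) (s : ℕ) (hs : s ≤ n)
    (hd : finrank ℝ E + (n - 1) + s < finrank ℝ F + 1) :
    ∃ T : (Fin n → ℝ) →ₗ[ℝ] F, ∀ v : Fin n → ℝ, v ≠ 0 → (∀ i : Fin n, s ≤ i → v i = 0) →
      ∀ A ∈ E, ∀ x, T v + A ≠ B v x := by
  induction s with
  | zero =>
    refine ⟨0, fun v hv h => absurd (funext fun i => h i (Nat.zero_le _)) hv⟩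
  | succ k ih =>
    obtain ⟨T, hT⟩ := ih (by omega) (by omega)
    obtain ⟨w, hw⟩ := exists_avoid B hB E T ⟨k, hs⟩ (by simp only; omega)
    refine ⟨T + (LinearMap.proj (⟨k, hs⟩ : Fin n)).smulRight w, fun v hv h A hA x heq => ?_⟩
    simp only [LinearMap.add_apply, LinearMap.smulRight_apply, LinearMap.proj_apply] at heq
    by_cases hk : v ⟨k, hs⟩ = 0
    · rw [hk, zero_smul, add_zero] at heq
      refine hT v hv (fun i hi => ?_) A hA x heq
      rcases hi.eq_or_lt with h' | h'
      · have : i = ⟨k, hs⟩ := Fin.ext h'.symm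
        rw [this, hk]
      · exact h i h'
    · refine hw ((v ⟨k, hs⟩)⁻¹ • v) ?_ ?_ ((v ⟨k, hs⟩)⁻¹ • A) (E.smul_mem _ hA) x ?_
      · simp [hk]
      · intro i hi
        have : v i = 0 := h i hi
        simp [this]
      · rw [map_smul, map_smul, LinearMap.smul_apply, ← heq, smul_add, smul_add, smul_smul,
          inv_mul_cancel₀ hk, one_smul]

lemma contractRight_map {V W : Type*} [AddCommGroup V] [Module ℝ V] [AddCommGroup W] [Module ℝ W]
    (j : V →ₗ[ℝ] W) (d : Module.Dual ℝ W) (h : ∀ v, d (j v) = 0) (x : ExteriorAlgebra ℝ V) :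
    CliffordAlgebra.contractRight (ExteriorAlgebra.map j x) d = 0 := by
  induction x using CliffordAlgebra.right_induction with
  | algebraMap r =>
    rw [AlgHom.commutes]
    exact CliffordAlgebra.contractRight_algebraMap _ _ _
  | add x y hx hy => rw [map_add, map_add, LinearMap.add_apply, hx, hy, add_zero]
  | mul_ι m x hx =>
    have : ExteriorAlgebra.map j (CliffordAlgebra.ι 0 m) = ι ℝ (j m) :=
      ExteriorAlgebra.map_apply_ι j m
    rw [map_mul, this]
    erw [CliffordAlgebra.contractRight_mul_ι]
    rw [h, hx, zero_smul, zero_mul, sub_zero]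

lemma contractRight_two {V : Type*} [AddCommGroup V] [Module ℝ V] (d : Module.Dual ℝ V)
    (A : ExteriorAlgebra ℝ V) (hA : A ∈ ⋀[ℝ]^2 V) :
    ∃ x : V, CliffordAlgebra.contractRight A d = ι ℝ x := by
  rw [ExteriorAlgebra.exteriorPower, pow_two] at hA
  induction hA using Submodule.mul_induction_on' with
  | mem_mul_mem a ha b hb =>
    obtain ⟨a, rfl⟩ := ha
    obtain ⟨b, rfl⟩ := hb
    refine ⟨d b • a - d a • b, ?_⟩
    rw [CliffordAlgebra.contractRight_mul_ι, CliffordAlgebra.contractRight_ι, map_sub, map_smul,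
      map_smul, Algebra.algebraMap_eq_smul_one, smul_mul_assoc, one_mul]
  | add a _ b _ ha hb =>
    obtain ⟨x, hx⟩ := ha
    obtain ⟨y, hy⟩ := hb
    exact ⟨x + y, by rw [map_add, LinearMap.add_apply, hx, hy, map_add]⟩

lemma decomp {n : ℕ} (A : ExteriorAlgebra ℝ (Fin n → ℝ)) (hA : A ∈ ⋀[ℝ]^2 (Fin n → ℝ))
    (v : Fin n → ℝ) (hv : v ≠ 0) (h : A * ι ℝ v = 0) : ∃ x, A = ι ℝ v * ι ℝ x := by
  obtain ⟨i, hi⟩ := Function.ne_iff.1 hv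
  let d : Module.Dual ℝ (Fin n → ℝ) := (v i)⁻¹ • LinearMap.proj i
  have hd : d v = 1 := by
    simpa [d] using inv_mul_cancel₀ hi
  obtain ⟨x, hx⟩ := contractRight_two d A hA
  have h2 := CliffordAlgebra.contractRight_mul_ι (Q := (0 : QuadraticForm ℝ (Fin n → ℝ))) d v A
  have h' : A * CliffordAlgebra.ι 0 v = 0 := h
  rw [h', hd, hx, map_zero, LinearMap.zero_apply, one_smul] at h2
  refine ⟨-x, ?_⟩
  have h3 := ExteriorAlgebra.ι_add_mul_swap (R := ℝ) x v
  rw [map_neg, mul_neg, ← eq_neg_of_add_eq_zero_left h3]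
  exact (sub_eq_zero.1 h2.symm)

lemma sum_bound (n : ℕ) (hn : 4 ≤ n) (t : ℕ) (h2 : 2 ≤ t) (ht : t ≤ n - 1) :
    n + t - 1 ≤ ∑ i ∈ Finset.Icc 1 t, (n - i) := by
  induction t, h2 using Nat.le_induction with
  | base => simp [Finset.sum_Icc_succ_top]; omega
  | succ t h ih =>
    rw [Finset.sum_Icc_succ_top (by omega)]
    have := ih (by omega)
    omega

lemma sum_bound' (n s : ℕ) (hn : 4 ≤ n) (h1 : 1 ≤ s) (hs : s ≤ n) :
    n + s - 2 ≤ ∑ i ∈ Finset.Icc 1 s, (n - i) := by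
  rcases h1.eq_or_lt with rfl | h1
  · simp
  · rcases hs.eq_or_lt with rfl | hs
    · obtain ⟨k, rfl⟩ : ∃ k, s = k + 1 := ⟨s - 1, by omega⟩
      rw [Finset.sum_Icc_succ_top (by omega)]
      have := sum_bound (k + 1) hn k (by omega) (by omega)
      omega
    · have := sum_bound n hn s h1 (by omega)
      omega

/-- The wedge product of two vectors as an element of the second exterior power. -/
noncomputable def wedge (V : Type*) [AddCommGroup V] [Module ℝ V] :
    V →ₗ[ℝ] V →ₗ[ℝ] (⋀[ℝ]^2 V) :=
  LinearMap.mk₂ ℝ (fun v w => ⟨ι ℝ v * ι ℝ w, by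
      rw [ExteriorAlgebra.exteriorPower, pow_two]
      exact Submodule.mul_mem_mul ⟨v, rfl⟩ ⟨w, rfl⟩⟩)
    (fun a b c => Subtype.ext (by simp [add_mul]))
    (fun a b c => Subtype.ext (by simp))
    (fun a b c => Subtype.ext (by simp [mul_add]))
    (fun a b c => Subtype.ext (by simp))

lemma map_mem_two {V W : Type*} [AddCommGroup V] [Module ℝ V] [AddCommGroup W] [Module ℝ W]
    (j : V →ₗ[ℝ] W) (A : ExteriorAlgebra ℝ V) (hA : A ∈ ⋀[ℝ]^2 V) :
    ExteriorAlgebra.map j A ∈ ⋀[ℝ]^2 W := by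
  rw [ExteriorAlgebra.exteriorPower, pow_two] at hA
  induction hA using Submodule.mul_induction_on' with
  | mem_mul_mem a ha b hb =>
    obtain ⟨a, rfl⟩ := ha
    obtain ⟨b, rfl⟩ := hb
    rw [map_mul, ExteriorAlgebra.map_apply_ι, ExteriorAlgebra.map_apply_ι]
    exact (wedge W (j a) (j b)).2
  | add a _ b _ ha hb =>
    rw [map_add]
    exact Submodule.add_mem _ ha hb

/-- The core algebraic splitting: `X + Y ∧ e = 0` forces `X = 0` and `Y = 0`. -/
lemma split_zero {V W : Type*} [AddCommGroup V] [Module ℝ V] [AddCommGroup W] [Module ℝ W]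
    (j : V →ₗ[ℝ] W) (p : W →ₗ[ℝ] V) (hp : p ∘ₗ j = LinearMap.id)
    (d : Module.Dual ℝ W) (hd : ∀ v, d (j v) = 0) (e : W) (he : d e = 1)
    (X Y : ExteriorAlgebra ℝ V)
    (h : ExteriorAlgebra.map j X + ExteriorAlgebra.map j Y * ι ℝ e = 0) : X = 0 ∧ Y = 0 := by
  have inj : ∀ Z, ExteriorAlgebra.map j Z = 0 → Z = 0 := by
    intro Z hZ
    have h1 : (ExteriorAlgebra.map p).comp (ExteriorAlgebra.map j) = AlgHom.id ℝ _ := by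
      rw [ExteriorAlgebra.map_comp_map, hp, ExteriorAlgebra.map_id]
    have := DFunLike.congr_fun h1 Z
    rw [AlgHom.comp_apply, hZ, map_zero] at this
    exact this.symm
  have hY : Y = 0 := by
    apply inj
    have := congrArg (fun z => CliffordAlgebra.contractRight z d) h
    simp only [map_add, LinearMap.add_apply, map_zero, LinearMap.zero_apply] at this
    rw [contractRight_map j d hd, CliffordAlgebra.contractRight_mul_ι,
      contractRight_map j d hd, he] at this
    simpa using this
  subst hY
  exact ⟨inj _ (by simpa using h), rfl⟩

theorem stmt_9 (n s m : ℕ) (hn : 4 ≤ n) (hs1 : 1 ≤ s) (hsn : s ≤ n)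
    (hub : ∀ E : Submodule ℝ (ExteriorAlgebra ℝ (Fin n → ℝ)),
      E ≤ ⋀[ℝ]^2 (Fin n → ℝ) → IsPrimeSub E → Module.finrank ℝ E ≤ m)
    (hex : ∃ E : Submodule ℝ (ExteriorAlgebra ℝ (Fin n → ℝ)),
      E ≤ ⋀[ℝ]^2 (Fin n → ℝ) ∧ IsPrimeSub E ∧ Module.finrank ℝ E = m)
    (hlt : m + ∑ i ∈ Finset.Icc 1 s, (n - i) < n * (n - 1) / 2) :
    ∃ E' : Submodule ℝ (ExteriorAlgebra ℝ (Fin (n + 1) → ℝ)),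
      E' ≤ ⋀[ℝ]^2 (Fin (n + 1) → ℝ) ∧ IsPrimeSub E' ∧
        m + s ≤ Module.finrank ℝ E' := by
  obtain ⟨E, hE2, hEp, hEm⟩ := hex
  let F := ⋀[ℝ]^2 (Fin n → ℝ)
  have hF : finrank ℝ F = n * (n - 1) / 2 := by
    rw [exteriorPower.finrank_eq, finrank_fin_fun, Nat.choose_two_right]
  let E2 : Submodule ℝ F := E.comap F.subtype
  have hE2m : finrank ℝ E2 = m := by
    rw [← hEm]
    exact (Submodule.comapSubtypeEquivOfLe hE2).finrank_eq
  have hsb := sum_bound' n s hn hs1 hsn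
  obtain ⟨T, hT⟩ := exists_T (wedge (Fin n → ℝ))
    (fun v => Subtype.ext (ExteriorAlgebra.ι_sq_zero v)) E2 s hsn
    (by
      have hF' : finrank ℝ (⋀[ℝ]^2 (Fin n → ℝ)) = n * (n - 1) / 2 := hF
      rw [hE2m, hF']; omega)
  -- the setup on the larger space
  let j : (Fin n → ℝ) →ₗ[ℝ] (Fin (n + 1) → ℝ) :=
    LinearMap.pi (Fin.lastCases 0 (fun i => LinearMap.proj i))
  have hjl : ∀ v, j v (Fin.last n) = 0 := fun v => by simp [j]
  have hjc : ∀ v (i : Fin n), j v i.castSucc = v i := fun v i => by simp [j]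
  let p : (Fin (n + 1) → ℝ) →ₗ[ℝ] (Fin n → ℝ) := LinearMap.funLeft ℝ ℝ Fin.castSucc
  have hp : p ∘ₗ j = LinearMap.id := by
    refine LinearMap.ext fun v => funext fun i => ?_
    exact hjc v i
  let d : Module.Dual ℝ (Fin (n + 1) → ℝ) := LinearMap.proj (Fin.last n)
  let e : Fin (n + 1) → ℝ := Pi.single (Fin.last n) 1
  have hde : d e = 1 := by simp [d, e]
  have hdec : ∀ μ : Fin (n + 1) → ℝ, μ = j (p μ) + μ (Fin.last n) • e := by
    intro μ
    funext i
    refine Fin.lastCases ?_ (fun i => ?_) i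
    · simp [hjl, e]
    · simp [hjc, e, p, LinearMap.funLeft_apply]
  have key := split_zero j p hp d hjl e hde
  let q : Fin n → Prop := fun i => (i : ℕ) < s
  let c : (({i // q i} → ℝ)) →ₗ[ℝ] (Fin n → ℝ) := extZ q
  -- the form on the smaller space
  let G : (E × ({i // q i} → ℝ)) →ₗ[ℝ] ExteriorAlgebra ℝ (Fin n → ℝ) :=
    E.subtype ∘ₗ LinearMap.fst ℝ _ _ + F.subtype ∘ₗ T ∘ₗ c ∘ₗ LinearMap.snd ℝ _ _
  have hG : ∀ z, G z = (z.1 : ExteriorAlgebra ℝ (Fin n → ℝ)) + (T (c z.2) : F) := fun z => rfl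
  have hGF : ∀ z, G z ∈ F := fun z => by
    rw [hG]; exact F.add_mem (hE2 z.1.2) (T (c z.2)).2
  let Φ : (E × ({i // q i} → ℝ)) →ₗ[ℝ] ExteriorAlgebra ℝ (Fin (n + 1) → ℝ) :=
    (ExteriorAlgebra.map j).toLinearMap ∘ₗ G +
      (LinearMap.mulRight ℝ (ι ℝ e)) ∘ₗ (ι ℝ) ∘ₗ j ∘ₗ c ∘ₗ LinearMap.snd ℝ _ _
  have hΦ : ∀ z, Φ z = ExteriorAlgebra.map j (G z) +
      ExteriorAlgebra.map j (ι ℝ (c z.2)) * ι ℝ e := fun z => by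
    rw [ExteriorAlgebra.map_apply_ι]; rfl
  -- the forms avoid all decomposables through the vector
  have hav : ∀ z x, c z.2 ≠ 0 → G z ≠ ι ℝ (c z.2) * ι ℝ x := by
    intro z x hz h
    refine hT (c z.2) hz (fun i hi => extZ_not q _ i (not_lt.2 hi)) ⟨z.1, hE2 z.1.2⟩ z.1.2 x ?_
    refine Subtype.ext ?_
    rw [hG, add_comm] at h
    exact h
  have hinj : Function.Injective Φ := by
    rw [← LinearMap.ker_eq_bot, LinearMap.ker_eq_bot']
    intro z hz
    rw [hΦ] at hz
    obtain ⟨h1, h2⟩ := key _ _ hz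
    rw [ExteriorAlgebra.ι_eq_zero_iff] at h2
    rw [hG, h2, map_zero] at h1
    refine Prod.ext (Subtype.ext ?_) (extZ_inj q _ h2)
    simpa using h1
  refine ⟨LinearMap.range Φ, ?_, ?_, ?_⟩
  · rintro _ ⟨z, rfl⟩
    rw [hΦ, ExteriorAlgebra.map_apply_ι]
    exact Submodule.add_mem _ (map_mem_two j _ (hGF z)) (wedge _ _ _).2
  · rintro _ ⟨z, rfl⟩ hz μ hμ h0
    set a := p μ with ha
    set t := μ (Fin.last n) with ht
    have hμ' : μ = j a + t • e := hdec μ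
    have hexp : ExteriorAlgebra.map j (G z * ι ℝ a) +
        ExteriorAlgebra.map j (t • G z - ι ℝ (c z.2) * ι ℝ a) * ι ℝ e = 0 := by
      rw [← h0, hΦ, hμ']
      have hsw := ExteriorAlgebra.ι_add_mul_swap (R := ℝ) e (j a)
      have hee := ExteriorAlgebra.ι_sq_zero (R := ℝ) e
      have hsw' := eq_neg_of_add_eq_zero_left hsw
      simp only [map_mul, map_sub, map_smul, map_add, ExteriorAlgebra.map_apply_ι, mul_add,
        add_mul, sub_mul, mul_smul_comm, smul_mul_assoc]
      rw [mul_assoc _ (ι ℝ e) (ι ℝ e), hee, mul_assoc _ (ι ℝ e) (ι ℝ (j a)), hsw', mul_zero,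
        add_zero, mul_neg, mul_assoc _ (ι ℝ (j a)) (ι ℝ e)]
      abel
    obtain ⟨h1, h2⟩ := key _ _ hexp
    rw [sub_eq_zero] at h2
    by_cases hv : c z.2 = 0
    · have hz2 : z.2 = 0 := extZ_inj q _ hv
      have hGz : G z = z.1 := by rw [hG, hv, map_zero]; simp
      have hz1 : (z.1 : ExteriorAlgebra ℝ (Fin n → ℝ)) ≠ 0 := by
        intro h
        apply hz
        have : z = 0 := Prod.ext (Subtype.ext h) hz2
        rw [this, map_zero]
      rw [hv, map_zero, zero_mul, hGz] at h2
      rw [hGz] at h1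
      rcases smul_eq_zero.1 h2 with h | h
      · refine hEp _ z.1.2 hz1 a ?_ h1
        intro ha0
        apply hμ
        rw [hμ', ha0, h]; simp
      · exact hz1 h
    · by_cases h : t = 0
      · have ha0 : a ≠ 0 := by
          intro ha0
          apply hμ
          rw [hμ', ha0, h]; simp
        rw [h, zero_smul] at h2
        -- the vector is proportional to a
        have hprop : G z * ι ℝ (c z.2) = 0 := by
          obtain ⟨i, hi⟩ := Function.ne_iff.1 ha0
          have h3 := CliffordAlgebra.contractRight_mul_ι (Q := (0 : QuadraticForm ℝ (Fin n → ℝ)))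
            (LinearMap.proj i) a (CliffordAlgebra.ι 0 (c z.2))
          have h2' : CliffordAlgebra.ι (0 : QuadraticForm ℝ (Fin n → ℝ)) (c z.2) *
            CliffordAlgebra.ι 0 a = 0 := h2.symm
          rw [h2', map_zero, LinearMap.zero_apply, CliffordAlgebra.contractRight_ι,
            Algebra.algebraMap_eq_smul_one, smul_mul_assoc, one_mul] at h3
          have h4 : a i • ι ℝ (c z.2) = (c z.2) i • ι ℝ a := sub_eq_zero.1 h3.symm
          have h5 : a i • (G z * ι ℝ (c z.2)) = 0 := by
            rw [← mul_smul_comm, h4, mul_smul_comm, h1, smul_zero]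
          exact (smul_eq_zero.1 h5).resolve_left hi
        obtain ⟨x, hx⟩ := decomp (G z) (hGF z) _ hv hprop
        exact hav z x hv hx
      · refine hav z (t⁻¹ • a) hv ?_
        rw [map_smul, mul_smul_comm, ← h2, smul_smul, inv_mul_cancel₀ h, one_smul]
  · have hfE : FiniteDimensional ℝ E :=
      Module.Finite.equiv (Submodule.comapSubtypeEquivOfLe hE2)
    rw [LinearMap.finrank_range_of_inj hinj, finrank_prod, hEm, finrank_fintype_fun_eq_card]
    have : Fintype.card {i // q i} = s := by
      rw [Fintype.card_subtype]
      have := Fin.card_filter_val_lt (n := n) (m := s)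
      simp [q]; omega
    rw [this]
end

section
/- Let e₁,…,e₈ be the standard basis of ℝ⁸ and let α₁ = e_{12}+e_{34}+e_{56}+e_{78}, α₂ = e_{13}−e_{24}+e_{57}−e_{68}, α₃ = e_{14}+e_{23}−e_{58}−e_{67}, α₄ = e_{15}−e_{26}−e_{37}+e_{48}, α₅ = e_{16}+e_{25}+e_{38}+e_{47}, α₆ = e_{17}−e_{28}+e_{35}−e_{46}, α₇ = e_{18}+e_{27}−e_{36}−e_{45} in ⋀²(ℝ⁸), where e_{ij} = eᵢ∧eⱼ. Then span{αᵢ ∧ v : 1 ≤ i ≤ 7, v ∈ ℝ⁸} = ⋀³(ℝ⁸); that is, the products of Λ₇² = span{α₁,…,α₇} with 1-forms span all of ⋀³(ℝ⁸). -/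
set_option maxHeartbeats 2000000
set_option synthInstance.maxHeartbeats 400000

open ExteriorAlgebra

/-- the standard basis of `ℝ⁸` inside the exterior algebra (`e8 0, …, e8 7` correspond
to `e₁, …, e₈`). -/
noncomputable def e8 (i : Fin 8) : ExteriorAlgebra ℝ (Fin 8 → ℝ) :=
  ι ℝ (Pi.single i (1 : ℝ))

/-- the seven 2-forms `α₁, …, α₇` spanning `Λ₇² ⊆ ⋀²(ℝ⁸)` (0-indexed). -/
noncomputable def alphaForm : Fin 7 → ExteriorAlgebra ℝ (Fin 8 → ℝ) :=
  ![e8 0 * e8 1 + e8 2 * e8 3 + e8 4 * e8 5 + e8 6 * e8 7,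
    e8 0 * e8 2 - e8 1 * e8 3 + e8 4 * e8 6 - e8 5 * e8 7,
    e8 0 * e8 3 + e8 1 * e8 2 - e8 4 * e8 7 - e8 5 * e8 6,
    e8 0 * e8 4 - e8 1 * e8 5 - e8 2 * e8 6 + e8 3 * e8 7,
    e8 0 * e8 5 + e8 1 * e8 4 + e8 2 * e8 7 + e8 3 * e8 6,
    e8 0 * e8 6 - e8 1 * e8 7 + e8 2 * e8 4 - e8 3 * e8 5,
    e8 0 * e8 7 + e8 1 * e8 6 - e8 2 * e8 5 - e8 3 * e8 4]

/-- An alternating array of reals on `Fin 8` killed by the seven families of relations vanishes. -/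
theorem alt_vanish (t : Fin 8 → Fin 8 → Fin 8 → ℝ)
    (h1 : ∀ a b c, t a b c = - t b a c) (h2 : ∀ a b c, t a b c = - t a c b)
    (r0 : ∀ v, t 0 1 v + t 2 3 v + t 4 5 v + t 6 7 v = 0)
    (r1 : ∀ v, t 0 2 v - t 1 3 v + t 4 6 v - t 5 7 v = 0)
    (r2 : ∀ v, t 0 3 v + t 1 2 v - t 4 7 v - t 5 6 v = 0)
    (r3 : ∀ v, t 0 4 v - t 1 5 v - t 2 6 v + t 3 7 v = 0)
    (r4 : ∀ v, t 0 5 v + t 1 4 v + t 2 7 v + t 3 6 v = 0)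
    (r5 : ∀ v, t 0 6 v - t 1 7 v + t 2 4 v - t 3 5 v = 0)
    (r6 : ∀ v, t 0 7 v + t 1 6 v - t 2 5 v - t 3 4 v = 0) :
    ∀ a b c, t a b c = 0 := by
  have z1 : ∀ a c, t a a c = 0 := fun a c => by linarith [h1 a a c]
  have z2 : ∀ a c, t a c c = 0 := fun a c => by linarith [h2 a c c]
  have z3 : ∀ a c, t a c a = 0 := fun a c => by linarith [h2 a c a, z1 a c]
  have s1 : ∀ a b c, b < a → t a b c = - t b a c := fun a b c _ => h1 a b c
  have s2 : ∀ a b c, c < b → t a b c = - t a c b := fun a b c _ => h2 a b c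
  -- it suffices to treat increasing triples
  suffices H : ∀ a b c, a < b → b < c → t a b c = 0 by
    intro a b c
    rcases lt_trichotomy a b with hab | rfl | hab
    · rcases lt_trichotomy b c with hbc | rfl | hbc
      · exact H _ _ _ hab hbc
      · exact z2 _ _
      · rcases lt_trichotomy a c with hac | rfl | hac
        · rw [h2, H _ _ _ hac hbc, neg_zero]
        · exact z3 _ _
        · rw [h2, h1, H _ _ _ hac hab]; simp
    · exact z1 _ _
    · rcases lt_trichotomy a c with hac | rfl | hac
      · rw [h1, H _ _ _ hab hac, neg_zero]
      · exact z3 _ _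
      · rcases lt_trichotomy b c with hbc | rfl | hbc
        · rw [h1, h2, H _ _ _ hbc hac]; simp
        · exact z2 _ _
        · rw [h1, h2, h1, H _ _ _ hbc hab]; simp
  simp only [Fin.forall_fin_succ, Fin.isValue] at r0 r1 r2 r3 r4 r5 r6
  simp [z2, z3] at r0 r1 r2 r3 r4 r5 r6
  simp (disch := decide) only [s1, s2] at r0 r1 r2 r3 r4 r5 r6
  simp only [neg_neg] at r0 r1 r2 r3 r4 r5 r6
  obtain ⟨p00, p01, p02, p03, p04, p05, p06, p07⟩ := r0
  obtain ⟨p10, p11, p12, p13, p14, p15, p16, p17⟩ := r1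
  obtain ⟨p20, p21, p22, p23, p24, p25, p26, p27⟩ := r2
  obtain ⟨p30, p31, p32, p33, p34, p35, p36, p37⟩ := r3
  obtain ⟨p40, p41, p42, p43, p44, p45, p46, p47⟩ := r4
  obtain ⟨p50, p51, p52, p53, p54, p55, p56, p57⟩ := r5
  obtain ⟨p60, p61, p62, p63, p64, p65, p66, p67⟩ := r6
  clear h1 h2 z1 z2 z3 s1 s2
  intro a b c hab hbc
  fin_cases a <;> fin_cases b <;> first
    | (exfalso; revert hab; decide)
    | (fin_cases c <;> first
        | (exfalso; revert hbc; decide)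
        | (clear hab hbc; simp only [Fin.reduceFinMk, Fin.zero_eta, Fin.mk_one]; linarith))

/-- the wedge products of `Λ₇² = span{α₁,…,α₇}` with 1-forms span all of
`⋀³(ℝ⁸)`. -/
theorem stmt_16 :
    Submodule.span ℝ
        {z : ExteriorAlgebra ℝ (Fin 8 → ℝ) |
          ∃ i : Fin 7, ∃ v : Fin 8 → ℝ, z = alphaForm i * ι ℝ v} =
      ⋀[ℝ]^3 (Fin 8 → ℝ) := by
  have hι : ∀ v : Fin 8 → ℝ, ι ℝ v ∈ LinearMap.range (ι ℝ : (Fin 8 → ℝ) →ₗ[ℝ] _) :=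
    fun v => ⟨v, rfl⟩
  apply le_antisymm
  · rw [Submodule.span_le]
    rintro _ ⟨i, v, rfl⟩
    have h2 : ∀ a b, e8 a * e8 b ∈ (LinearMap.range (ι ℝ : (Fin 8 → ℝ) →ₗ[ℝ] _)) ^ 2 := by
      intro a b
      rw [pow_two]
      exact Submodule.mul_mem_mul (hι _) (hι _)
    have hA : alphaForm i ∈ (LinearMap.range (ι ℝ : (Fin 8 → ℝ) →ₗ[ℝ] _)) ^ 2 := by
      fin_cases i <;> simp only [alphaForm] <;>
      repeat' first
        | exact h2 _ _
        | apply Submodule.add_mem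
        | apply Submodule.sub_mem
    change _ ∈ (LinearMap.range (ι ℝ : (Fin 8 → ℝ) →ₗ[ℝ] _)) ^ 3
    rw [pow_succ]
    exact Submodule.mul_mem_mul hA (hι v)
  · have hr : LinearMap.range (ι ℝ : (Fin 8 → ℝ) →ₗ[ℝ] _) = Submodule.span ℝ (Set.range e8) := by
      rw [LinearMap.range_eq_map, ← (Pi.basisFun ℝ (Fin 8)).span_eq, Submodule.map_span,
        ← Set.range_comp]
      congr 2
      ext i
      simp [e8]
    change (LinearMap.range (ι ℝ : (Fin 8 → ℝ) →ₗ[ℝ] _)) ^ 3 ≤ _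
    rw [hr, pow_succ, pow_two, Submodule.span_mul_span, Submodule.span_mul_span, Submodule.span_le]
    intro z hz
    obtain ⟨_, ⟨_, ⟨a, rfl⟩, _, ⟨b, rfl⟩, rfl⟩, _, ⟨c, rfl⟩, rfl⟩ := hz
    by_contra hn
    obtain ⟨f, hf, hS⟩ := Submodule.exists_le_ker_of_notMem hn
    apply hf
    have hsw : ∀ a b, e8 a * e8 b = - (e8 b * e8 a) := fun a b =>
      eq_neg_of_add_eq_zero_left (ι_add_mul_swap _ _)
    have hk : ∀ i v, f (alphaForm i * e8 v) = 0 := fun i v =>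
      hS (Submodule.subset_span ⟨i, _, rfl⟩)
    refine alt_vanish (fun a b c => f (e8 a * e8 b * e8 c)) ?_ ?_ ?_ ?_ ?_ ?_ ?_ ?_ ?_ a b c
    · intro a b c
      rw [hsw a b, neg_mul, map_neg]
    · intro a b c
      rw [mul_assoc, hsw b c, mul_neg, map_neg, mul_assoc]
    · intro v; simpa [alphaForm, add_mul, sub_mul] using hk 0 v
    · intro v; simpa [alphaForm, add_mul, sub_mul] using hk 1 v
    · intro v; simpa [alphaForm, add_mul, sub_mul] using hk 2 v
    · intro v; simpa [alphaForm, add_mul, sub_mul] using hk 3 v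
    · intro v; simpa [alphaForm, add_mul, sub_mul] using hk 4 v
    · intro v; simpa [alphaForm, add_mul, sub_mul] using hk 5 v
    · intro v; simpa [alphaForm, add_mul, sub_mul] using hk 6 v
end

section
/- Let e₁,…,e₈ be the standard basis of ℝ⁸, write e_{ijkl} = eᵢ∧eⱼ∧e_k∧e_l, and define the seven 4-forms β₁ = e_{2467}+e_{2458}+e_{2368}−e_{2357}−e_{1358}−e_{1367}−e_{1457}+e_{1468}, β₂ = e_{3467}+e_{3458}+e_{2378}+e_{2356}+e_{1258}+e_{1267}+e_{1456}+e_{1478}, β₃ = e_{3457}−e_{3468}+e_{2478}+e_{2456}+e_{1257}−e_{1268}−e_{1356}−e_{1378}, β₄ = e_{2345}−e_{4567}−e_{3568}+e_{2578}−e_{1238}−e_{1247}+e_{1346}+e_{1678}, β₅ = e_{4568}−e_{3567}+e_{2678}+e_{2346}−e_{1237}+e_{1248}−e_{1345}−e_{1578}, β₆ = e_{4578}+e_{3678}+e_{2567}+e_{2347}+e_{1236}+e_{1245}+e_{1348}+e_{1568}, β₇ = e_{3578}−e_{4678}+e_{2568}+e_{2348}+e_{1235}−e_{1246}−e_{1347}−e_{1567}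 in ⋀⁴(ℝ⁸). Then span{β₁,…,β₇} is a prime subspace of ⋀⁴(ℝ⁸): every nonzero linear combination β of β₁,…,β₇ satisfies β ∧ λ ≠ 0 for every nonzero λ ∈ ℝ⁸. -/
set_option maxHeartbeats 2000000
set_option synthInstance.maxHeartbeats 400000

open ExteriorAlgebra

/-- the seven 4-forms `β₁, …, β₇` spanning `Λ₇⁴ ⊆ ⋀⁴(ℝ⁸)` (0-indexed). -/
noncomputable def betaForm : Fin 7 → ExteriorAlgebra ℝ (Fin 8 → ℝ) :=
  ![e8 1 * e8 3 * e8 5 * e8 6 + e8 1 * e8 3 * e8 4 * e8 7 + e8 1 * e8 2 * e8 5 * e8 7 -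
      e8 1 * e8 2 * e8 4 * e8 6 - e8 0 * e8 2 * e8 4 * e8 7 - e8 0 * e8 2 * e8 5 * e8 6 -
      e8 0 * e8 3 * e8 4 * e8 6 + e8 0 * e8 3 * e8 5 * e8 7,
    e8 2 * e8 3 * e8 5 * e8 6 + e8 2 * e8 3 * e8 4 * e8 7 + e8 1 * e8 2 * e8 6 * e8 7 +
      e8 1 * e8 2 * e8 4 * e8 5 + e8 0 * e8 1 * e8 4 * e8 7 + e8 0 * e8 1 * e8 5 * e8 6 +
      e8 0 * e8 3 * e8 4 * e8 5 + e8 0 * e8 3 * e8 6 * e8 7,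
    e8 2 * e8 3 * e8 4 * e8 6 - e8 2 * e8 3 * e8 5 * e8 7 + e8 1 * e8 3 * e8 6 * e8 7 +
      e8 1 * e8 3 * e8 4 * e8 5 + e8 0 * e8 1 * e8 4 * e8 6 - e8 0 * e8 1 * e8 5 * e8 7 -
      e8 0 * e8 2 * e8 4 * e8 5 - e8 0 * e8 2 * e8 6 * e8 7,
    e8 1 * e8 2 * e8 3 * e8 4 - e8 3 * e8 4 * e8 5 * e8 6 - e8 2 * e8 4 * e8 5 * e8 7 +
      e8 1 * e8 4 * e8 6 * e8 7 - e8 0 * e8 1 * e8 2 * e8 7 - e8 0 * e8 1 * e8 3 * e8 6 +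
      e8 0 * e8 2 * e8 3 * e8 5 + e8 0 * e8 5 * e8 6 * e8 7,
    e8 3 * e8 4 * e8 5 * e8 7 - e8 2 * e8 4 * e8 5 * e8 6 + e8 1 * e8 5 * e8 6 * e8 7 +
      e8 1 * e8 2 * e8 3 * e8 5 - e8 0 * e8 1 * e8 2 * e8 6 + e8 0 * e8 1 * e8 3 * e8 7 -
      e8 0 * e8 2 * e8 3 * e8 4 - e8 0 * e8 4 * e8 6 * e8 7,
    e8 3 * e8 4 * e8 6 * e8 7 + e8 2 * e8 5 * e8 6 * e8 7 + e8 1 * e8 4 * e8 5 * e8 6 +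
      e8 1 * e8 2 * e8 3 * e8 6 + e8 0 * e8 1 * e8 2 * e8 5 + e8 0 * e8 1 * e8 3 * e8 4 +
      e8 0 * e8 2 * e8 3 * e8 7 + e8 0 * e8 4 * e8 5 * e8 7,
    e8 2 * e8 4 * e8 6 * e8 7 - e8 3 * e8 5 * e8 6 * e8 7 + e8 1 * e8 4 * e8 5 * e8 7 +
      e8 1 * e8 2 * e8 3 * e8 7 + e8 0 * e8 1 * e8 2 * e8 4 - e8 0 * e8 1 * e8 3 * e8 5 -
      e8 0 * e8 2 * e8 3 * e8 6 - e8 0 * e8 4 * e8 5 * e8 6]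

/-- Natural numbers as indices. -/
def idx8 (n : ℕ) : Fin 8 := Fin.ofNat 8 n

lemma idx8_0 : idx8 0 = 0 := rfl
lemma idx8_1 : idx8 1 = 1 := rfl
lemma idx8_2 : idx8 2 = 2 := rfl
lemma idx8_3 : idx8 3 = 3 := rfl
lemma idx8_4 : idx8 4 = 4 := rfl
lemma idx8_5 : idx8 5 = 5 := rfl
lemma idx8_6 : idx8 6 = 6 := rfl
lemma idx8_7 : idx8 7 = 7 := rfl

/-- Ordered product of basis vectors. -/
noncomputable def eList (l : List ℕ) : ExteriorAlgebra ℝ (Fin 8 → ℝ) :=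
  (l.map fun n => e8 (idx8 n)).prod

/-- The sign encoded by a Boolean (`true` is negative). -/
def sg (s : Bool) : ℤ := cond s (-1) 1

lemma sg_not (s : Bool) : sg (!s) = -sg s := by cases s <;> rfl

lemma sg_xor (s t : Bool) : sg (s ^^ t) = sg s * sg t := by cases s <;> cases t <;> rfl

/-- Value of an optional signed monomial (`none` is zero). -/
noncomputable def optVal : Option (Bool × List ℕ) → ExteriorAlgebra ℝ (Fin 8 → ℝ)
  | none => 0
  | some (s, l) => (sg s : ℝ) • eList l

/-- Signed insertion into a sorted monomial. -/
def signedInsert (a : ℕ) : List ℕ → Option (Bool × List ℕ)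
  | [] => some (false, [a])
  | b :: l => match Nat.blt a b with
    | true => some (false, a :: b :: l)
    | false => match Nat.beq a b with
      | true => none
      | false => match signedInsert a l with
        | none => none
        | some (s, m) => some (!s, b :: m)

/-- Signed insertion sort. -/
def signedSort : List ℕ → Option (Bool × List ℕ)
  | [] => some (false, [])
  | a :: l => match signedSort l with
    | none => none
    | some (s, m) => match signedInsert a m with
      | none => none
      | some (t, k) => some (s ^^ t, k)

lemma iota_anticomm (u v : Fin 8 → ℝ) : ι ℝ u * ι ℝ v = -(ι ℝ v * ι ℝ u) :=
  eq_neg_of_add_eq_zero_left (ι_add_mul_swap u v)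

lemma eList_cons (a : ℕ) (l : List ℕ) : eList (a :: l) = e8 (idx8 a) * eList l := by
  simp [eList]

lemma signedInsert_spec (a : ℕ) (l : List ℕ) :
    e8 (idx8 a) * eList l = optVal (signedInsert a l) := by
  induction l with
  | nil => simp [signedInsert, eList, optVal, sg]
  | cons b l ih =>
    unfold signedInsert
    split
    · simp [optVal, sg, eList_cons]
    · split
      · rename_i h
        obtain rfl := Nat.eq_of_beq_eq_true h
        rw [eList_cons, ← mul_assoc]
        simp [optVal, e8]
      · have hab : e8 (idx8 a) * e8 (idx8 b) =
          -(e8 (idx8 b) * e8 (idx8 a)) := iota_anticomm _ _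
        rw [eList_cons, ← mul_assoc, hab, neg_mul, mul_assoc, ih]
        split
        · rename_i h
          simp [h, optVal]
        · rename_i h
          simp [h, optVal, sg_not, eList_cons]

lemma signedSort_spec (l : List ℕ) : eList l = optVal (signedSort l) := by
  induction l with
  | nil => simp [signedSort, optVal, sg]
  | cons a l ih =>
    rw [eList_cons, ih]
    simp only [signedSort]
    split
    · rename_i h
      simp [h, optVal]
    · rename_i s m h
      rw [h]
      have h2 := signedInsert_spec a m
      simp only [optVal, mul_smul_comm]
      rw [h2]
      rcases hi : signedInsert a m with _ | ⟨t, k⟩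
      · simp [optVal]
      · simp [optVal, sg_xor, smul_smul]

/-- The full list of indices. -/
def fullList : List ℕ := [0, 1, 2, 3, 4, 5, 6, 7]

lemma det_std (n : ℕ) : Matrix.detRowAlternating
    (fun i : Fin n => (Pi.single i (1 : ℝ) : Fin n → ℝ)) = (1 : ℝ) := by
  have h3 : (fun i : Fin n => (Pi.single i (1 : ℝ) : Fin n → ℝ)) = (1 : Matrix _ _ ℝ) := by
    ext i j
    simp [Matrix.one_apply, Pi.single_apply, eq_comm]
  rw [h3]
  exact Matrix.det_one

lemma eList_full_ne_zero : eList fullList ≠ 0 := by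
  intro h
  have h1 : eList fullList = ιMulti ℝ 8 (fun i : Fin 8 => Pi.single i (1 : ℝ)) := by
    rw [ιMulti_apply]
    simp [eList, fullList, e8, List.ofFn_succ]
    rfl
  have h2 := liftAlternating_apply_ιMulti (R := ℝ) (M := Fin 8 → ℝ) (N := ℝ)
    (n := 8) (Pi.single (M := fun n => (Fin 8 → ℝ) [⋀^Fin n]→ₗ[ℝ] ℝ) 8
      (Matrix.detRowAlternating (n := Fin 8) (R := ℝ)))
    (fun i : Fin 8 => Pi.single i (1 : ℝ))
  rw [← h1, h, map_zero, Pi.single_eq_same] at h2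
  exact zero_ne_one (h2.trans (det_std 8))

/-- Integer data of the seven forms. -/
def betaData : Fin 7 → List (Bool × List ℕ) :=
  ![[(false, [1, 3, 5, 6]), (false, [1, 3, 4, 7]), (false, [1, 2, 5, 7]), (true, [1, 2, 4, 6]), (true, [0, 2, 4, 7]), (true, [0, 2, 5, 6]), (true, [0, 3, 4, 6]), (false, [0, 3, 5, 7])],
    [(false, [2, 3, 5, 6]), (false, [2, 3, 4, 7]), (false, [1, 2, 6, 7]), (false, [1, 2, 4, 5]), (false, [0, 1, 4, 7]), (false, [0, 1, 5, 6]), (false, [0, 3, 4, 5]), (false, [0, 3, 6, 7])],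
    [(false, [2, 3, 4, 6]), (true, [2, 3, 5, 7]), (false, [1, 3, 6, 7]), (false, [1, 3, 4, 5]), (false, [0, 1, 4, 6]), (true, [0, 1, 5, 7]), (true, [0, 2, 4, 5]), (true, [0, 2, 6, 7])],
    [(false, [1, 2, 3, 4]), (true, [3, 4, 5, 6]), (true, [2, 4, 5, 7]), (false, [1, 4, 6, 7]), (true, [0, 1, 2, 7]), (true, [0, 1, 3, 6]), (false, [0, 2, 3, 5]), (false, [0, 5, 6, 7])],
    [(false, [3, 4, 5, 7]), (true, [2, 4, 5, 6]), (false, [1, 5, 6, 7]), (false, [1, 2, 3, 5]), (true, [0, 1, 2, 6]), (false, [0, 1, 3, 7]), (true, [0, 2, 3, 4]), (true, [0, 4, 6, 7])],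
    [(false, [3, 4, 6, 7]), (false, [2, 5, 6, 7]), (false, [1, 4, 5, 6]), (false, [1, 2, 3, 6]), (false, [0, 1, 2, 5]), (false, [0, 1, 3, 4]), (false, [0, 2, 3, 7]), (false, [0, 4, 5, 7])],
    [(false, [2, 4, 6, 7]), (true, [3, 5, 6, 7]), (false, [1, 4, 5, 7]), (false, [1, 2, 3, 7]), (false, [0, 1, 2, 4]), (true, [0, 1, 3, 5]), (true, [0, 2, 3, 6]), (true, [0, 4, 5, 6])]]

/-- Evaluation of signed lists of monomials. -/
noncomputable def evalData (L : List (Bool × List ℕ)) : ExteriorAlgebra ℝ (Fin 8 → ℝ) :=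
  (L.map fun p => (sg p.1 : ℝ) • eList p.2).sum

lemma evalData_cons (p : Bool × List ℕ) (L : List (Bool × List ℕ)) :
    evalData (p :: L) = (sg p.1 : ℝ) • eList p.2 + evalData L := by simp [evalData]

lemma evalData_append (L M : List (Bool × List ℕ)) :
    evalData (L ++ M) = evalData L + evalData M := by simp [evalData]

lemma betaForm_eq (i : Fin 7) : betaForm i = evalData (betaData i) := by
  fin_cases i <;> simp [betaForm, betaData, evalData, eList, sg, mul_assoc,
    idx8_0, idx8_1, idx8_2, idx8_3, idx8_4, idx8_5, idx8_6, idx8_7] <;> abel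

/-- Formal product of lists of signed monomials. -/
def mulData : List (Bool × List ℕ) → List (Bool × List ℕ) → List (Bool × List ℕ)
  | [], _ => []
  | p :: L, M => M.map (fun q => (p.1 ^^ q.1, p.2 ++ q.2)) ++ mulData L M

lemma mulData_spec (L M : List (Bool × List ℕ)) :
    evalData L * evalData M = evalData (mulData L M) := by
  induction L with
  | nil => simp [evalData, mulData]
  | cons p L ih =>
    rw [evalData_cons, add_mul, ih, mulData, evalData_append]
    congr 1
    clear ih
    induction M with
    | nil => simp [evalData]
    | cons q M ih =>
      rw [evalData_cons, mul_add, ih, List.map_cons, evalData_cons, smul_mul_smul_comm]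
      simp [eList, sg_xor]

/-- Collects the coefficient of the volume form; fails on any other surviving monomial. -/
def collect : List (Bool × List ℕ) → ℤ → Option ℤ
  | [], acc => some acc
  | p :: L, acc => match signedSort p.2 with
    | none => collect L acc
    | some (t, m) => if m = fullList then collect L (acc + sg (p.1 ^^ t)) else none

lemma collect_spec (L : List (Bool × List ℕ)) (acc r : ℤ) (h : collect L acc = some r) :
    (acc : ℝ) • eList fullList + evalData L = (r : ℝ) • eList fullList := by
  induction L generalizing acc with
  | nil =>
    simp only [collect, Option.some.injEq] at h
    simp [evalData, h]
  | cons p L ih =>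
    rw [evalData_cons, signedSort_spec p.2]
    unfold collect at h
    split at h
    · rename_i h1
      rw [h1, ← ih _ h]
      simp [optVal]
    · rename_i t m h1
      split_ifs at h with h2
      rw [h1, ← ih _ h]
      simp only [optVal, h2, smul_smul, sg_xor]
      push_cast
      rw [add_smul, add_assoc]

lemma betaData_coef : ∀ i j, collect (mulData (betaData i) (betaData j)) 0 =
    some (if i = j then 8 else 0) := by
  decide +kernel

lemma beta_mul (i j : Fin 7) :
    betaForm i * betaForm j = (if i = j then (8 : ℝ) else 0) • eList fullList := by
  have h := collect_spec _ _ _ (betaData_coef i j)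
  rw [betaForm_eq, betaForm_eq, mulData_spec]
  rw [Int.cast_zero, zero_smul, zero_add] at h
  rw [h]
  split_ifs <;> simp

lemma commute_four (v : Fin 8 → ℝ) (a b c d : Fin 8) :
    Commute (e8 a * e8 b * e8 c * e8 d) (ι ℝ v) := by
  have h : ∀ i, e8 i * ι ℝ v = -(ι ℝ v * e8 i) := fun i => iota_anticomm _ _
  have h2 : ∀ i j, Commute (e8 i * e8 j) (ι ℝ v) := fun i j => by
    change e8 i * e8 j * ι ℝ v = ι ℝ v * (e8 i * e8 j)
    rw [mul_assoc, h, mul_neg, ← mul_assoc, h, neg_mul, neg_neg, mul_assoc]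
  rw [mul_assoc (e8 a * e8 b)]
  exact (h2 a b).mul_left (h2 c d)

lemma betaData_length : ∀ i, ∀ p ∈ betaData i, p.2.length = 4 := by decide

lemma commute_beta (v : Fin 8 → ℝ) (i : Fin 7) : Commute (betaForm i) (ι ℝ v) := by
  rw [betaForm_eq]
  have h := betaData_length i
  generalize betaData i = L at h
  induction L with
  | nil => simp [evalData]
  | cons p L ih =>
    rw [evalData_cons]
    refine Commute.add_left (Commute.smul_left ?_ _) (ih fun q hq => h q (by simp [hq]))
    obtain ⟨a, b, c, d, hp⟩ := List.length_eq_four.1 (h p (by simp))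
    rw [hp]
    simpa [eList, mul_assoc] using commute_four v _ _ _ _

/-- `Λ₇⁴ = span{β₁,…,β₇}` is a prime subspace of `⋀⁴(ℝ⁸)`. -/
theorem stmt_18 :
    ∀ β ∈ Submodule.span ℝ (Set.range betaForm), β ≠ 0 →
      ∀ lam : Fin 8 → ℝ, lam ≠ 0 → β * ι ℝ lam ≠ 0 := by
  intro β hβ hne lam hlam h0
  obtain ⟨c, rfl⟩ := (Submodule.mem_span_range_iff_exists_fun ℝ).1 hβ
  set β := ∑ i, c i • betaForm i with hβdef
  have hcomm : β * ι ℝ lam = ι ℝ lam * β :=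
    Commute.sum_left _ _ _ fun i _ => (commute_beta lam i).smul_left (c i)
  obtain ⟨k, hk⟩ := Function.ne_iff.1 hlam
  have hk' : lam k ≠ 0 := hk
  let d : Module.Dual ℝ (Fin 8 → ℝ) := LinearMap.proj k
  have hcon := CliffordAlgebra.contractLeft_ι_mul (Q := (0 : QuadraticForm ℝ (Fin 8 → ℝ)))
    (d := d) lam β
  set γ := CliffordAlgebra.contractLeft d β with hγ
  have hz : CliffordAlgebra.ι (0 : QuadraticForm ℝ (Fin 8 → ℝ)) lam * β = 0 := by
    rw [hcomm] at h0
    exact h0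
  rw [hz, map_zero] at hcon
  have hfac : lam k • β = ι ℝ lam * γ := (sub_eq_zero.1 hcon.symm)
  have hsq : β * β = 0 := by
    have h1 : lam k • (β * β) = 0 := by
      rw [← mul_smul_comm, hfac, ← mul_assoc, h0, zero_mul]
    exact (smul_eq_zero.1 h1).resolve_left hk'
  have hsq2 : β * β = (8 * ∑ i, c i ^ 2) • eList fullList := by
    rw [hβdef, Finset.sum_mul_sum]
    simp only [smul_mul_smul_comm, beta_mul, smul_smul]
    simp only [← Finset.sum_smul]
    congr 1
    simp [Finset.mul_sum]
    exact Finset.sum_congr rfl fun i _ => by ring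
  rw [hsq2] at hsq
  have hs : ∑ i, c i ^ 2 = 0 := by
    have := (smul_eq_zero.1 hsq).resolve_right eList_full_ne_zero
    linarith
  have hc := (Finset.sum_eq_zero_iff_of_nonneg fun i _ => sq_nonneg (c i)).1 hs
  apply hne
  rw [hβdef]
  refine Finset.sum_eq_zero fun i hi => ?_
  rw [pow_eq_zero_iff (two_ne_zero) |>.1 (hc i hi), zero_smul]
end

section
/- Let e₁,…,e₈ be the standard basis of ℝ⁸ and let β₁,…,β₇ ∈ ⋀⁴(ℝ⁸) be the seven 4-forms β₁ = e_{2467}+e_{2458}+e_{2368}−e_{2357}−e_{1358}−e_{1367}−e_{1457}+e_{1468}, β₂ = e_{3467}+e_{3458}+e_{2378}+e_{2356}+e_{1258}+e_{1267}+e_{1456}+e_{1478}, β₃ = e_{3457}−e_{3468}+e_{2478}+e_{2456}+e_{1257}−e_{1268}−e_{1356}−e_{1378}, β₄ = e_{2345}−e_{4567}−e_{3568}+e_{2578}−e_{1238}−e_{1247}+e_{1346}+e_{1678}, β₅ = e_{4568}−e_{3567}+e_{2678}+e_{2346}−e_{1237}+e_{1248}−e_{1345}−e_{1578}, β₆ =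 e_{4578}+e_{3678}+e_{2567}+e_{2347}+e_{1236}+e_{1245}+e_{1348}+e_{1568}, β₇ = e_{3578}−e_{4678}+e_{2568}+e_{2348}+e_{1235}−e_{1246}−e_{1347}−e_{1567}, where e_{ijkl} = eᵢ∧eⱼ∧e_k∧e_l. Then span{βᵢ ∧ v : 1 ≤ i ≤ 7, v ∈ ℝ⁸} = ⋀⁵(ℝ⁸); that is, the products of Λ₇⁴ = span{β₁,…,β₇} with 1-forms span all of ⋀⁵(ℝ⁸). -/
set_option maxHeartbeats 2000000
set_option synthInstance.maxHeartbeats 400000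

open ExteriorAlgebra

/-- A five-argument function on indices that is skew under adjacent swaps, vanishes when two
adjacent indices agree, and kills the 56 relations, vanishes on increasing indices. -/
theorem functional_zero (f : ExteriorAlgebra ℝ (Fin 8 → ℝ) →ₗ[ℝ] ℝ)
    (H : ∀ i k, f (betaForm i * e8 k) = 0) (a b c d e : Fin 8)
    (hab : a < b) (hbc : b < c) (hcd : c < d) (hde : d < e) :
    f (e8 a * e8 b * e8 c * e8 d * e8 e) = 0 := by
  have sq : ∀ i, e8 i * e8 i = 0 := fun i => ι_sq_zero _
  have sw : ∀ i j, e8 i * e8 j = - (e8 j * e8 i) := fun i j =>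
    eq_neg_of_add_eq_zero_left (ι_add_mul_swap _ _)
  obtain ⟨F, hF⟩ : ∃ F : Fin 8 → Fin 8 → Fin 8 → Fin 8 → Fin 8 → ℝ,
      ∀ a b c d e, f (e8 a * e8 b * e8 c * e8 d * e8 e) = F a b c d e :=
    ⟨fun a b c d e => f (e8 a * e8 b * e8 c * e8 d * e8 e), fun _ _ _ _ _ => rfl⟩
  have z1 : ∀ a c d e, F a a c d e = 0 := by intro a c d e; simp [← hF, sq]
  have z2 : ∀ a b d e, F a b b d e = 0 := by intro a b d e; simp [← hF, mul_assoc _ _ (e8 b), sq]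
  have z3 : ∀ a b c e, F a b c c e = 0 := by intro a b c e; simp [← hF, mul_assoc _ _ (e8 c), sq]
  have z4 : ∀ a b c d, F a b c d d = 0 := by intro a b c d; simp [← hF, mul_assoc _ _ (e8 d), sq]
  have s1 : ∀ a b c d e, b < a → F a b c d e = - F b a c d e := by
    intro a b c d e _; rw [← hF, ← hF, sw a b]; simp
  have s2 : ∀ a b c d e, c < b → F a b c d e = - F a c b d e := by
    intro a b c d e _; rw [← hF, ← hF, mul_assoc (e8 a), sw b c]; simp [mul_assoc]
  have s3 : ∀ a b c d e, d < c → F a b c d e = - F a b d c e := by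
    intro a b c d e _; rw [← hF, ← hF, mul_assoc (e8 a * e8 b) (e8 c), sw c d]; simp [mul_assoc]
  have s4 : ∀ a b c d e, e < d → F a b c d e = - F a b c e d := by
    intro a b c d e _; rw [← hF, ← hF, mul_assoc (_ * _ * _), sw d e]; simp [mul_assoc]
  rw [hF]
  have K : ∀ k : Fin 8, ∀ i, f (betaForm i * e8 k) = 0 := fun k i => H i k
  have hall : ∀ k : Fin 8, k = 0 ∨ k = 1 ∨ k = 2 ∨ k = 3 ∨ k = 4 ∨ k = 5 ∨ k = 6 ∨ k = 7 := by
    decide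
  simp only [Fin.forall_fin_succ (n := 6), Fin.forall_fin_succ (n := 5),
    Fin.forall_fin_succ (n := 4), Fin.forall_fin_succ (n := 3), Fin.forall_fin_succ (n := 2),
    Fin.forall_fin_succ (n := 1), Fin.forall_fin_succ (n := 0), betaForm, Matrix.cons_val_zero,
    Matrix.cons_val_succ, IsEmpty.forall_iff, and_true, add_mul, sub_mul, map_add, map_sub, hF]
    at K
  have K0 := K 0
  have K1 := K 1
  have K2 := K 2
  have K3 := K 3
  have K4 := K 4
  have K5 := K 5
  have K6 := K 6
  have K7 := K 7
  clear K H
  simp (disch := decide) only [z1, z2, z3, z4, s1, s2, s3, s4, neg_neg, neg_zero]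
    at K0 K1 K2 K3 K4 K5 K6 K7
  clear z1 z2 z3 z4 s1 s2 s3 s4 sq sw hF
  casesm* _ ∧ _
  rcases hall a with rfl | rfl | rfl | rfl | rfl | rfl | rfl | rfl <;>
  rcases hall b with rfl | rfl | rfl | rfl | rfl | rfl | rfl | rfl <;>
  first
  | exact absurd hab (by decide)
  | (rcases hall c with rfl | rfl | rfl | rfl | rfl | rfl | rfl | rfl <;>
     first
     | exact absurd hbc (by decide)
     | (rcases hall d with rfl | rfl | rfl | rfl | rfl | rfl | rfl | rfl <;>
        first
        | exact absurd hcd (by decide)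
        | (rcases hall e with rfl | rfl | rfl | rfl | rfl | rfl | rfl | rfl <;>
           first
           | exact absurd hde (by decide)
           | linarith)))

/-- the wedge products of `Λ₇⁴ = span{β₁,…,β₇}` with 1-forms span all of
`⋀⁵(ℝ⁸)`. -/
theorem stmt_19 :
    Submodule.span ℝ
        {z : ExteriorAlgebra ℝ (Fin 8 → ℝ) |
          ∃ i : Fin 7, ∃ v : Fin 8 → ℝ, z = betaForm i * ι ℝ v} =
      ⋀[ℝ]^5 (Fin 8 → ℝ) := by
  have hmem : ∀ i, betaForm i ∈ ⋀[ℝ]^4 (Fin 8 → ℝ) := by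
    have h4 : ∀ a b c d, e8 a * e8 b * e8 c * e8 d ∈ ⋀[ℝ]^4 (Fin 8 → ℝ) := by
      intro a b c d
      have h1 : ∀ i, e8 i ∈ LinearMap.range (ι ℝ : (Fin 8 → ℝ) →ₗ[ℝ] _) := fun i => ⟨_, rfl⟩
      simp only [exteriorPower, pow_succ, pow_zero, one_mul]
      exact Submodule.mul_mem_mul (Submodule.mul_mem_mul (Submodule.mul_mem_mul (h1 a) (h1 b))
        (h1 c)) (h1 d)
    intro i
    fin_cases i <;> simp only [betaForm] <;>
    repeat' first
      | exact h4 _ _ _ _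
      | apply Submodule.add_mem
      | apply Submodule.sub_mem
  apply le_antisymm
  · rw [Submodule.span_le]
    rintro z ⟨i, v, rfl⟩
    change _ ∈ (LinearMap.range (ι ℝ : (Fin 8 → ℝ) →ₗ[ℝ] _)) ^ (4 + 1)
    rw [pow_succ]
    exact Submodule.mul_mem_mul (hmem i) ⟨v, rfl⟩
  · rw [← ιMulti_span_fixedDegree, Submodule.span_le]
    rintro _ ⟨w, rfl⟩
    by_contra hw
    obtain ⟨f, hf, hker⟩ := Submodule.exists_le_ker_of_notMem hw
    apply hf
    have H : ∀ i k, f (betaForm i * e8 k) = 0 := fun i k =>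
      hker (Submodule.subset_span ⟨i, _, rfl⟩)
    have hz : f.compAlternatingMap (ιMulti ℝ 5 (M := Fin 8 → ℝ)) = 0 := by
      refine Module.Basis.ext_alternating (Pi.basisFun ℝ (Fin 8)) fun v hv => ?_
      have hm : StrictMono (v ∘ Tuple.sort v) :=
        (Tuple.monotone_sort v).strictMono_of_injective (hv.comp (Equiv.injective _))
      have h0 := functional_zero f H _ _ _ _ _ (hm (show (0 : Fin 5) < 1 by decide))
        (hm (show (1 : Fin 5) < 2 by decide)) (hm (show (2 : Fin 5) < 3 by decide))
        (hm (show (3 : Fin 5) < 4 by decide))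
      have h1 := (f.compAlternatingMap (ιMulti ℝ 5 (M := Fin 8 → ℝ))).map_perm
        (fun i => Pi.basisFun ℝ (Fin 8) (v i)) (Tuple.sort v)
      have h2 : f.compAlternatingMap (ιMulti ℝ 5 (M := Fin 8 → ℝ))
          ((fun i => Pi.basisFun ℝ (Fin 8) (v i)) ∘ Tuple.sort v) = 0 := by
        rw [← h0]
        simp [ιMulti_apply, e8, mul_assoc]
        rfl
      rw [h2] at h1
      rcases Int.units_eq_one_or (Equiv.Perm.sign (Tuple.sort v)) with hs | hs <;>
        rw [hs] at h1 <;> simpa using h1.symm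
    exact congrArg (fun g => g w) hz
end
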